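/- arXiv:0806.2165 — 2 statements merged into one kernel-verified Lean document; each statement's English description precedes it below -/
import Mathlib

section
/- Let G be a finite group, k a field of characteristic p dividing |G|, and M, N finitely generated non-projective indecomposable kG-modules such that N is not stably isomorphic to Ω^i M for any integer i. Then the connecting map φ: N → ΩN of the almost split sequence 0 → Ω²N → B → N → 0 is nonzero in the stable module category, yet the induced map φ_*: Ext^i(M, N) → Ext^i(M, ΩN) on Tate Ext groups is zero for all i. -/
open CategoryTheory

namespace StmodGH

/-- The trivial `kG`-module `k`, as a module over the group algebra. -/
noncomputable def triv (k G : Type) [Field k] [Group G] : ModuleCat (MonoidAlgebra k G) :=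
  ModuleCat.of _ (Representation.trivial k (G := G) (V := k)).asModule

variable {A : Type} [Ring A]

/-- A map is zero in the stable module category iff it factors through a projective. -/
def StablyZero {M N : ModuleCat A} (f : M ⟶ N) : Prop :=
  ∃ P : ModuleCat A, Projective P ∧ ∃ (g : M ⟶ P) (h : P ⟶ N), f = g ≫ h

/-- Two modules are isomorphic in the stable module category. -/
def StablyIso (M N : ModuleCat A) : Prop :=
  ∃ (f : M ⟶ N) (g : N ⟶ M), StablyZero (f ≫ g - 𝟙 M) ∧ StablyZero (g ≫ f - 𝟙 N)

/-- A short exact sequence `0 → X → Y → Z → 0` of modules. -/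
structure SES (X Y Z : ModuleCat A) where
  i : X ⟶ Y
  p : Y ⟶ Z
  inj : Function.Injective i
  surj : Function.Surjective p
  exact : ∀ y : Y, p y = 0 ↔ ∃ x, i x = y

/-- `Ω` is a family of syzygies/cosyzygies of `M`: `Ω 0 ≃ M` stably, and each
`Ω (i+1)` is the kernel of a surjection from a (finitely generated) projective onto `Ω i`. -/
def IsSyzygyFamily (M : ModuleCat A) (Ω : ℤ → ModuleCat A) : Prop :=
  (∀ i, Module.Finite A (Ω i)) ∧ StablyIso (Ω 0) M ∧
    ∀ i : ℤ, ∃ P : ModuleCat A, Projective P ∧ Nonempty (SES (Ω (i + 1)) P (Ω i))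

/-- Indecomposability, via idempotent endomorphisms. -/
def Indecomp (M : ModuleCat A) : Prop :=
  ¬ Limits.IsZero M ∧ ∀ f : M ⟶ M, f ≫ f = f → f = 0 ∨ f = 𝟙 M

/-- Membership in the thick subcategory of the stable module category generated by `G₀`:
the smallest class containing `G₀`, containing the (stably trivial) projective modules,
closed under stable isomorphism, under exact triangles (equivalently, two-out-of-three for
short exact sequences), and under direct summands. -/
inductive InThick (G₀ : ModuleCat A) : ModuleCat A → Prop
  | gen : InThick G₀ G₀
  | proj (P : ModuleCat A) : Projective P → InThick G₀ P
  | iso {M N : ModuleCat A} : StablyIso M N → InThick G₀ M → InThick G₀ N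
  | ext₁ {X Y Z : ModuleCat A} : SES X Y Z → InThick G₀ X → InThick G₀ Y → InThick G₀ Z
  | ext₂ {X Y Z : ModuleCat A} : SES X Y Z → InThick G₀ X → InThick G₀ Z → InThick G₀ Y
  | ext₃ {X Y Z : ModuleCat A} : SES X Y Z → InThick G₀ Y → InThick G₀ Z → InThick G₀ X
  | summand {M N : ModuleCat A} : (∃ (s : M ⟶ N) (r : N ⟶ M), s ≫ r = 𝟙 M) →
      InThick G₀ N → InThick G₀ M

/-- A short exact sequence `0 → X → B → N → 0` is almost split: it is non-split, has
indecomposable end terms, and every map to `N` that is not a split epimorphism factors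
through the middle term `B`. -/
def IsAlmostSplit {X B N : ModuleCat A} (s : SES X B N) : Prop :=
  Indecomp X ∧ Indecomp N ∧ (¬ ∃ sec : N ⟶ B, sec ≫ s.p = 𝟙 N) ∧
    ∀ (M : ModuleCat A) (f : M ⟶ N),
      (¬ ∃ sec : N ⟶ M, sec ≫ f = 𝟙 N) → ∃ g : M ⟶ B, g ≫ s.p = f

/-- The generating hypothesis for `kG`: every map in the thick subcategory generated by the
trivial module which induces the zero map on Tate cohomology
`Ĥ^i(G,−) = Hom_stmod(Ω^i k, −)` is zero in the stable module category. -/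
def GHolds (k G : Type) [Field k] [Group G] [Fintype G] : Prop :=
  ∀ Ωk : ℤ → ModuleCat (MonoidAlgebra k G), IsSyzygyFamily (triv k G) Ωk →
    ∀ M N : ModuleCat (MonoidAlgebra k G), InThick (triv k G) M → InThick (triv k G) N →
      ∀ f : M ⟶ N, (∀ (i : ℤ) (g : Ωk i ⟶ M), StablyZero (g ≫ f)) → StablyZero f

section ModuleLemmas

universe u

namespace StablyZero

variable {L M N : ModuleCat.{u} A}

lemma comp_left {f : M ⟶ N} (hf : StablyZero f) (g : L ⟶ M) : StablyZero (g ≫ f) := by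
  obtain ⟨P, hP, a, b, rfl⟩ := hf
  exact ⟨P, hP, g ≫ a, b, by simp⟩

lemma comp_right {f : L ⟶ M} (hf : StablyZero f) (g : M ⟶ N) : StablyZero (f ≫ g) := by
  obtain ⟨P, hP, a, b, rfl⟩ := hf
  exact ⟨P, hP, a, b ≫ g, by simp⟩

lemma neg {f : M ⟶ N} (hf : StablyZero f) : StablyZero (-f) := by
  simpa using hf.comp_right (-𝟙 N)

lemma add {f g : M ⟶ N} (hf : StablyZero f) (hg : StablyZero g) : StablyZero (f + g) := by
  obtain ⟨P, hP, a, b, rfl⟩ := hf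
  obtain ⟨Q, hQ, c, d, rfl⟩ := hg
  exact ⟨P ⊞ Q, inferInstance, Limits.biprod.lift a c, Limits.biprod.desc b d, by simp⟩

lemma sub {f g : M ⟶ N} (hf : StablyZero f) (hg : StablyZero g) : StablyZero (f - g) := by
  simpa [sub_eq_add_neg] using hf.add hg.neg

end StablyZero

lemma StablyIso.symm {M N : ModuleCat.{u} A} (h : StablyIso M N) : StablyIso N M := by
  obtain ⟨f, g, hfg, hgf⟩ := h
  exact ⟨g, f, hgf, hfg⟩

namespace SES

variable {X Y Z X' Y' Z' W : ModuleCat.{u} A}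

lemma comp_zero (s : SES X Y Z) : s.i ≫ s.p = 0 := by
  ext x
  exact (s.exact _).2 ⟨x, rfl⟩

lemma shortExact (s : SES X Y Z) : (ShortComplex.mk s.i s.p s.comp_zero).ShortExact where
  exact := (ShortComplex.moduleCat_exact_iff _).2 fun y hy => (s.exact y).1 hy
  mono_f := (ModuleCat.mono_iff_injective _).2 s.inj
  epi_g := (ModuleCat.epi_iff_surjective _).2 s.surj

lemma mono_i (s : SES X Y Z) : Mono s.i := s.shortExact.mono_f

lemma epi_p (s : SES X Y Z) : Epi s.p := s.shortExact.epi_g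

lemma exists_lift (s : SES X Y Z) (f : W ⟶ Y) (hf : f ≫ s.p = 0) : ∃ g : W ⟶ X, g ≫ s.i = f :=
  have := s.mono_i
  ⟨s.shortExact.exact.lift f hf, s.shortExact.exact.lift_f f hf⟩

lemma exists_desc (s : SES X Y Z) (f : Y ⟶ W) (hf : s.i ≫ f = 0) : ∃ g : Z ⟶ W, s.p ≫ g = f :=
  have := s.epi_p
  ⟨s.shortExact.exact.desc f hf, s.shortExact.exact.g_desc f hf⟩

/-- In a morphism of short exact sequences with projective middle term in the source, the left
component is stably zero as soon as the right one is. -/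
lemma stablyZero_left (s : SES X Y Z) (t : SES X' Y' Z') [Projective Y]
    {d : X ⟶ X'} {D : Y ⟶ Y'} {d' : Z ⟶ Z'} (h : d ≫ t.i = s.i ≫ D)
    (h' : s.p ≫ d' = D ≫ t.p) (hd' : StablyZero d') : StablyZero d := by
  obtain ⟨Q, hQ, a, b, rfl⟩ := hd'
  have := t.epi_p
  have := t.mono_i
  obtain ⟨c, hc⟩ : ∃ c : Q ⟶ Y', c ≫ t.p = b := ⟨_, Projective.factorThru_comp b t.p⟩
  obtain ⟨u, hu⟩ := t.exists_lift (D - s.p ≫ a ≫ c) (by simp [hc, h'])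
  refine ⟨Y, ‹_›, s.i, u, ?_⟩
  rw [← cancel_mono t.i, h, Category.assoc, hu, Preadditive.comp_sub, reassoc_of% s.comp_zero]
  simp

/-- If projectives are injective, then in a morphism of short exact sequences with projective
middle term in the target, the right component is stably zero as soon as the left one is. -/
lemma stablyZero_right (hA : ∀ P : ModuleCat.{u} A, Projective P → Injective P)
    (s : SES X Y Z) (t : SES X' Y' Z') [Projective Y'] {d : X ⟶ X'} {D : Y ⟶ Y'} {d' : Z ⟶ Z'}
    (h : d ≫ t.i = s.i ≫ D) (h' : s.p ≫ d' = D ≫ t.p) (hd : StablyZero d) : StablyZero d' := by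
  obtain ⟨Q, hQ, a, b, rfl⟩ := hd
  have := s.epi_p
  have := s.mono_i
  have := hA Q hQ
  obtain ⟨c, hc⟩ : ∃ c : Y ⟶ Q, s.i ≫ c = a := ⟨_, Injective.comp_factorThru a s.i⟩
  obtain ⟨v, hv⟩ := s.exists_desc (D - c ≫ b ≫ t.i) (by simp [reassoc_of% hc, ← h])
  refine ⟨Y', ‹_›, v, t.p, ?_⟩
  rw [← cancel_epi s.p, h', reassoc_of% hv, Preadditive.sub_comp]
  simp [t.comp_zero]

end SES

/-- Every endomorphism which is stably idempotent is stably `0` or stably the identity. -/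
def StablyIndecomp (M : ModuleCat A) : Prop :=
  ∀ e : M ⟶ M, StablyZero (e ≫ e - e) → StablyZero e ∨ StablyZero (e - 𝟙 M)

namespace StablyIndecomp

variable {M N X P Y : ModuleCat.{u} A}

lemma of_stablyIso (h : StablyIso M N) (hM : StablyIndecomp M) : StablyIndecomp N := by
  obtain ⟨f, g, hfg, hgf⟩ := h
  intro e he
  have key : StablyZero ((f ≫ e ≫ g) ≫ f ≫ e ≫ g - f ≫ e ≫ g) := by
    have h1 := ((hgf.comp_right (e ≫ g)).comp_left (f ≫ e)).add ((he.comp_right g).comp_left f)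
    convert h1 using 1
    simp
  rcases hM _ key with h0 | h1
  · left
    have h2 := (h0.comp_right f).comp_left g
    have h3 := hgf.comp_right (e ≫ g ≫ f)
    have h4 := hgf.comp_left e
    convert (h2.sub h3).sub h4 using 1
    simp
  · right
    have h2 := (h1.comp_right f).comp_left g
    have h3 := hgf.comp_right (e ≫ g ≫ f)
    have h4 := hgf.comp_left e
    convert ((h2.sub h3).sub h4).add hgf using 1
    simp

lemma syzygy (hA : ∀ P : ModuleCat.{u} A, Projective P → Injective P) (s : SES X P Y)
    [Projective P] (hY : StablyIndecomp Y) : StablyIndecomp X := by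
  intro e he
  have := s.mono_i
  have := hA P ‹_›
  obtain ⟨D, hD⟩ : ∃ D : P ⟶ P, s.i ≫ D = e ≫ s.i := ⟨_, Injective.comp_factorThru _ s.i⟩
  obtain ⟨e', he'⟩ := s.exists_desc (D ≫ s.p) (by rw [reassoc_of% hD, s.comp_zero]; simp)
  have key := SES.stablyZero_right hA s s (D := D ≫ D - D) (d' := e' ≫ e' - e')
    (by simp [hD, reassoc_of% hD]) (by simp [he', reassoc_of% he']) he
  refine (hY e' key).imp (s.stablyZero_left s hD.symm he') fun h => ?_
  exact s.stablyZero_left s (D := D - 𝟙 P) (by simp [hD]) (by simp [he']) h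

lemma cosyzygy (hA : ∀ P : ModuleCat.{u} A, Projective P → Injective P) (s : SES X P Y)
    [Projective P] (hX : StablyIndecomp X) : StablyIndecomp Y := by
  intro e he
  have := s.epi_p
  obtain ⟨D, hD⟩ : ∃ D : P ⟶ P, D ≫ s.p = s.p ≫ e := ⟨_, Projective.factorThru_comp _ s.p⟩
  obtain ⟨e', he'⟩ := s.exists_lift (s.i ≫ D) (by
    rw [Category.assoc, hD, reassoc_of% s.comp_zero, Limits.zero_comp])
  have key := SES.stablyZero_left s s (D := D ≫ D - D) (d := e' ≫ e' - e')
    (by simp [he', reassoc_of% he']) (by simp [hD, reassoc_of% hD]) he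
  refine (hX e' key).imp (s.stablyZero_right hA s he' hD.symm) fun h => ?_
  exact s.stablyZero_right hA s (D := D - 𝟙 P) (by simp [he']) (by simp [hD]) h

lemma of_isSyzygyFamily (hA : ∀ P : ModuleCat.{u} A, Projective P → Injective P)
    {Ω : ℤ → ModuleCat.{u} A} (hΩ : IsSyzygyFamily M Ω) (hM : StablyIndecomp M) (i : ℤ) :
    StablyIndecomp (Ω i) := by
  obtain ⟨-, h0, hs⟩ := hΩ
  induction i with
  | zero => exact hM.of_stablyIso h0.symm
  | succ n ih =>
    obtain ⟨P, hP, ⟨s⟩⟩ := hs n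
    exact ih.syzygy hA s
  | pred n ih =>
    obtain ⟨P, hP, ⟨s⟩⟩ := hs (-n - 1)
    rw [sub_add_cancel] at s
    exact ih.cosyzygy hA s

/-- A non-projective retract of a stably indecomposable module is stably isomorphic to it. -/
lemma stablyIso_of_retract (hM : StablyIndecomp M) (f : M ⟶ N) (σ : N ⟶ M) (h : σ ≫ f = 𝟙 N)
    (hN : ¬ Projective N) : StablyIso N M := by
  rcases hM (f ≫ σ) (by
    simpa [reassoc_of% h] using ⟨ModuleCat.of A PUnit, inferInstance, 0, 0, by simp⟩) with h0 | h1
  · obtain ⟨P, hP, a, b, hab⟩ := (h0.comp_right f).comp_left σ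
    refine absurd (Retract.projective (Y := P) ⟨a, b, ?_⟩) hN
    rw [← hab]
    simp [h]
  · exact ⟨σ, f, by simpa [h] using h1.comp_left σ |>.comp_right f, h1⟩

end StablyIndecomp

open LinearMap in
/-- Fitting's lemma: endomorphisms of an indecomposable module of finite length are nilpotent or
invertible. -/
lemma Indecomp.pow_eq_zero_or_isIso {M : ModuleCat.{u} A} [IsArtinian A M] [IsNoetherian A M]
    (hM : Indecomp M) (e : M ⟶ M) : (∃ n, e.hom ^ (n + 1) = 0) ∨ IsIso e := by
  obtain ⟨n, hn⟩ := Filter.eventually_atTop.1 (eventually_isCompl_ker_pow_range_pow e.hom)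
  specialize hn (n + 1) (by omega)
  set q := Submodule.projection _ _ hn with hq
  have hqq : ModuleCat.ofHom q ≫ ModuleCat.ofHom q = ModuleCat.ofHom q := by
    ext x
    exact Submodule.projection_apply_of_mem_left hn (Submodule.projection_apply_mem hn x)
  rcases hM.2 _ hqq with h | h
  · right
    have hker : ker (e.hom ^ (n + 1)) = ⊥ := by
      rw [← Submodule.range_projection hn, ← hq, show q = 0 from congrArg ModuleCat.Hom.hom h]
      exact range_zero
    have hinj : Function.Injective e.hom := by
      rw [← ker_eq_bot, eq_bot_iff, ← hker, pow_succ]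
      exact ker_le_ker_comp _ _
    have hbij : Function.Bijective e.hom := IsArtinian.bijective_of_injective_endomorphism _ hinj
    exact (ConcreteCategory.isIso_iff_bijective e).2 hbij
  · left
    refine ⟨n, ker_eq_top.1 ?_⟩
    rw [← Submodule.range_projection hn, ← hq, show q = .id from congrArg ModuleCat.Hom.hom h]
    exact range_id

lemma Indecomp.stablyIndecomp {M : ModuleCat.{u} A} [IsArtinian A M] [IsNoetherian A M]
    (hM : Indecomp M) : StablyIndecomp M := by
  intro e he
  rcases hM.pow_eq_zero_or_isIso e with ⟨n, hn⟩ | h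
  · left
    have key : ∀ m : ℕ, StablyZero (ModuleCat.ofHom (e.hom ^ (m + 1)) - e) := by
      intro m
      induction m with
      | zero => simpa using he.sub he
      | succ m ih =>
        convert (ih.comp_left e).add he using 1
        rw [pow_succ]
        ext x
        simp
    simpa [hn] using (key n).neg
  · right
    convert he.comp_left (inv e) using 1
    simp

section GroupAlgebra

variable {k G : Type} [Field k] [Group G] [Fintype G]

/-- Taking the coefficient at `1` in every coordinate of a free module over the group algebra. -/
noncomputable def coeffOne (I : Type u) :
    (I →₀ MonoidAlgebra k G) →ₗ[k] (I →₀ MonoidAlgebra k G) :=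
  Finsupp.mapRange.linearMap (MonoidAlgebra.lsingle (1 : G) ∘ₗ Finsupp.lapply (1 : G) ∘ₗ
    (MonoidAlgebra.coeffLinearEquiv k).toLinearMap)

/-- Higman's criterion for free modules: the identity is a trace. -/
lemma sum_conjugate_coeffOne (I : Type u) (x : I →₀ MonoidAlgebra k G) :
    ∑ g : G, (coeffOne (k := k) (G := G) I).conjugate g x = x := by
  ext i g
  simp only [LinearMap.conjugate_apply, coeffOne]
  suffices ∑ h : G, Finsupp.single h⁻¹ ((x i).coeff h⁻¹) g = (x i).coeff g by
    simpa [Finsupp.finsetSum_apply, MonoidAlgebra.coeff_single_mul_apply]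
  rw [Fintype.sum_eq_single g⁻¹ fun h hh => Finsupp.single_eq_of_ne fun hg => hh (by simp [hg])]
  simp

/-- Free modules over the group algebra of a finite group are injective. -/
lemma injective_free (I : Type u) :
    Module.Injective (MonoidAlgebra k G) (I →₀ MonoidAlgebra k G) where
  out X Y _ _ _ _ i hi f := by
    let : Module k X := Module.compHom X (algebraMap k (MonoidAlgebra k G))
    let : Module k Y := Module.compHom Y (algebraMap k (MonoidAlgebra k G))
    have : IsScalarTower k (MonoidAlgebra k G) X := IsScalarTower.of_algebraMap_smul fun _ _ => rfl
    have : IsScalarTower k (MonoidAlgebra k G) Y := IsScalarTower.of_algebraMap_smul fun _ _ => rfl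
    obtain ⟨r, hr⟩ := LinearMap.exists_leftInverse_of_injective (i.restrictScalars k)
      (LinearMap.ker_eq_bot.2 hi)
    refine ⟨(coeffOne I ∘ₗ f.restrictScalars k ∘ₗ r).sumOfConjugatesEquivariant G, fun x => ?_⟩
    rw [LinearMap.sumOfConjugatesEquivariant_apply, ← sum_conjugate_coeffOne I (f x)]
    refine Finset.sum_congr rfl fun g _ => ?_
    have hr' : ∀ x, r (i x) = x := fun x => LinearMap.congr_fun hr x
    simp only [LinearMap.conjugate_apply, LinearMap.comp_apply, ← map_smul, hr',
      LinearMap.restrictScalars_apply]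

/-- Projective modules over the group algebra of a finite group are injective. -/
lemma injective_of_projective (P : ModuleCat.{u} (MonoidAlgebra k G)) (hP : Projective P) :
    Injective P := by
  have := Module.injective_object_of_injective_module _ _
    (inj := injective_free (k := k) (G := G) P)
  obtain ⟨σ, hσ⟩ := Module.projective_def'.1 (P.projective_of_module_projective)
  exact Retract.injective (Y := ModuleCat.of _ (P →₀ MonoidAlgebra k G))
    ⟨ModuleCat.ofHom σ, ModuleCat.ofHom (Finsupp.linearCombination _ id),
      ModuleCat.hom_ext hσ⟩

end GroupAlgebra

section ConnectingMap

variable {X B N P Y : ModuleCat.{u} A} {s : SES X B N} {t : SES X P Y} {β : B ⟶ P} {φ : N ⟶ Y}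

/-- The connecting map of a non-split extension is not stably zero. -/
lemma not_stablyZero_connecting (hs : ¬ ∃ σ : N ⟶ B, σ ≫ s.p = 𝟙 N)
    (hβ : s.i ≫ β = t.i) (hφ : s.p ≫ φ = β ≫ t.p) : ¬ StablyZero φ := by
  rintro ⟨Q, hQ, a, b, rfl⟩
  have := t.epi_p
  have := t.mono_i
  obtain ⟨c, hc⟩ : ∃ c : Q ⟶ P, c ≫ t.p = b := ⟨_, Projective.factorThru_comp b t.p⟩
  obtain ⟨r, hr⟩ := t.exists_lift (β - s.p ≫ a ≫ c) (by simp [hc, hφ])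
  have hir : s.i ≫ r = 𝟙 X := by
    rw [← cancel_mono t.i, Category.assoc, hr, Preadditive.comp_sub, reassoc_of% s.comp_zero, hβ]
    simp
  have := s.epi_p
  obtain ⟨σ, hσ⟩ := s.exists_desc (𝟙 B - r ≫ s.i) (by simp [reassoc_of% hir])
  refine hs ⟨σ, ?_⟩
  rw [← cancel_epi s.p, reassoc_of% hσ, Preadditive.sub_comp]
  simp [s.comp_zero]

end ConnectingMap

end ModuleLemmas

/-- Let `G` be a finite group, `k` a field of characteristic `p` dividing
`|G|`, and `M, N` finitely generated non-projective indecomposable `kG`-modules such that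
`N` is not stably isomorphic to `Ω^i M` for any `i`. Then the connecting map `φ : N ⟶ ΩN`
of the almost split sequence `0 → Ω²N → B → N → 0` (constructed, as usual, from a
cosyzygy sequence `0 → Ω²N → P → ΩN → 0` with `P` projective, via a lift `β : B ⟶ P`)
is nonzero in the stable module category, while the induced map
`φ_* : Ext^i(M,N) → Ext^i(M,ΩN)` on Tate Ext groups, i.e. postcomposition with `φ` on
stable maps `Ω^i M ⟶ N`, is zero for every `i`. -/
theorem almost_split_connecting_map_is_nontrivial_ghost
    (k G : Type) [Field k] [Group G] [Fintype G]
    (p : ℕ) [Fact p.Prime] [CharP k p] (hp : p ∣ Fintype.card G)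
    (M N : ModuleCat (MonoidAlgebra k G))
    [Module.Finite (MonoidAlgebra k G) M] [Module.Finite (MonoidAlgebra k G) N]
    (hMind : Indecomp M) (hNind : Indecomp N)
    (hMnp : ¬ Projective M) (hNnp : ¬ Projective N)
    (ΩM : ℤ → ModuleCat (MonoidAlgebra k G)) (hΩM : IsSyzygyFamily M ΩM)
    (ΩN : ℤ → ModuleCat (MonoidAlgebra k G)) (hΩN : IsSyzygyFamily N ΩN)
    (hnot : ∀ i : ℤ, ¬ StablyIso N (ΩM i))
    -- the almost split sequence `0 → Ω²N → B → N → 0`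
    (X B : ModuleCat (MonoidAlgebra k G)) (s : SES X B N)
    (hAS : IsAlmostSplit s) (hX : StablyIso X (ΩN 2))
    -- data constructing the connecting map `φ : N ⟶ ΩN`
    (P Y : ModuleCat (MonoidAlgebra k G)) (hP : Projective P)
    (t : SES X P Y) (hY : StablyIso Y (ΩN 1))
    (β : B ⟶ P) (hβ : s.i ≫ β = t.i)
    (φ : N ⟶ Y) (hφ : s.p ≫ φ = β ≫ t.p) :
    ¬ StablyZero φ ∧ ∀ (i : ℤ) (f : ΩM i ⟶ N), StablyZero (f ≫ φ) := by
  refine ⟨not_stablyZero_connecting hAS.2.2.1 hβ hφ, fun i f => ?_⟩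
  have : IsArtinianRing (MonoidAlgebra k G) := .of_finite k _
  have : IsNoetherianRing (MonoidAlgebra k G) := .of_finite k _
  have hΩ := hMind.stablyIndecomp.of_isSyzygyFamily injective_of_projective hΩM i
  obtain ⟨g, rfl⟩ := hAS.2.2.2 _ f fun ⟨σ, hσ⟩ =>
    hnot i (hΩ.stablyIso_of_retract f σ hσ hNnp)
  exact ⟨P, hP, g ≫ β, t.p, by simp [hφ]⟩
end StmodGH
end

section
/- Let G be a finite group and k a field of characteristic p. If the Sylow p-subgroup of G has order at least 4, then the generating hypothesis fails for kG: there exist modules M, N in thick_G(k) and a nonzero stable map f: M → N inducing the zero map on Tate cohomology. -/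
open CategoryTheory

namespace StmodGH

variable {A : Type} [Ring A]

section Averaging

variable {k Q : Type} [Field k] [Group Q]
variable {X Y Z W : Type} [AddCommGroup X] [Module k X] [AddCommGroup Y] [Module k Y]
  [AddCommGroup Z] [Module k Z] [AddCommGroup W] [Module k W]
variable {ρ : Representation k Q X} {σ : Representation k Q Y} {τ : Representation k Q Z}

/-- Equivariance of a linear map between representations. -/
def Equi (ρ : Representation k Q X) (σ : Representation k Q Y) (f : X →ₗ[k] Y) : Prop :=
  ∀ u x, f (ρ u x) = σ u (f x)

/-- The average of a linear map over a finite group. -/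
noncomputable def avg [Fintype Q] (ρ : Representation k Q X) (σ : Representation k Q Y)
    (h : X →ₗ[k] Y) : X →ₗ[k] Y :=
  ∑ u, σ u ∘ₗ h ∘ₗ ρ u⁻¹

/-- A linear map is an average. -/
def IsAvg [Fintype Q] (ρ : Representation k Q X) (σ : Representation k Q Y)
    (f : X →ₗ[k] Y) : Prop :=
  ∃ h, f = avg ρ σ h

lemma Equi.id : Equi ρ ρ LinearMap.id := fun _ _ => rfl

lemma Equi.comp {g : Y →ₗ[k] Z} {f : X →ₗ[k] Y} (hg : Equi σ τ g) (hf : Equi ρ σ f) :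
    Equi ρ τ (g ∘ₗ f) := fun u x => by simp [hf u x, hg u]

lemma Equi.add {g f : X →ₗ[k] Y} (hg : Equi ρ σ g) (hf : Equi ρ σ f) :
    Equi ρ σ (g + f) := fun u x => by simp [hf u x, hg u]

lemma Equi.sub {g f : X →ₗ[k] Y} (hg : Equi ρ σ g) (hf : Equi ρ σ f) :
    Equi ρ σ (g - f) := fun u x => by simp [hf u x, hg u]

lemma Equi.smul {f : X →ₗ[k] Y} (c : k) (hf : Equi ρ σ f) :
    Equi ρ σ (c • f) := fun u x => by simp [hf u x]

lemma Equi.res {f : X →ₗ[k] Y} (P : Subgroup Q) (hf : Equi ρ σ f) :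
    Equi (ρ.comp P.subtype) (σ.comp P.subtype) f := fun u x => hf u x

variable [Fintype Q]

lemma avg_apply (h : X →ₗ[k] Y) (x : X) : avg ρ σ h x = ∑ u, σ u (h (ρ u⁻¹ x)) := by
  simp [avg]

lemma avg_equi (h : X →ₗ[k] Y) : Equi ρ σ (avg ρ σ h) := fun v x => by
  rw [avg_apply, avg_apply, map_sum]
  refine Fintype.sum_equiv (Equiv.mulLeft v⁻¹) _ _ fun u => ?_
  simp [← Module.End.mul_apply, ← map_mul]

lemma comp_avg {f : Y →ₗ[k] Z} (hf : Equi σ τ f) (h : X →ₗ[k] Y) :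
    f ∘ₗ avg ρ σ h = avg ρ τ (f ∘ₗ h) := by
  ext x
  simp [avg_apply, hf _ _]

lemma avg_comp {f : X →ₗ[k] Y} (hf : Equi ρ σ f) (h : Y →ₗ[k] Z) :
    avg σ τ h ∘ₗ f = avg ρ τ (h ∘ₗ f) := by
  ext x
  simp [avg_apply, hf _ _]

lemma avg_add (h h' : X →ₗ[k] Y) : avg ρ σ (h + h') = avg ρ σ h + avg ρ σ h' := by
  ext x
  simp [avg_apply, Finset.sum_add_distrib]

lemma avg_sub (h h' : X →ₗ[k] Y) : avg ρ σ (h - h') = avg ρ σ h - avg ρ σ h' := by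
  ext x
  simp [avg_apply, Finset.sum_sub_distrib]

lemma avg_smul (c : k) (h : X →ₗ[k] Y) : avg ρ σ (c • h) = c • avg ρ σ h := by
  ext x
  simp [avg_apply, Finset.smul_sum]

lemma IsAvg.comp_left {f : X →ₗ[k] Y} (hf : IsAvg ρ σ f) {g : Y →ₗ[k] Z} (hg : Equi σ τ g) :
    IsAvg ρ τ (g ∘ₗ f) := by
  obtain ⟨h, rfl⟩ := hf
  exact ⟨_, comp_avg hg h⟩

lemma IsAvg.comp_right {g : Y →ₗ[k] Z} (hg : IsAvg σ τ g) {f : X →ₗ[k] Y} (hf : Equi ρ σ f) :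
    IsAvg ρ τ (g ∘ₗ f) := by
  obtain ⟨h, rfl⟩ := hg
  exact ⟨_, avg_comp hf h⟩

lemma IsAvg.add {f g : X →ₗ[k] Y} (hf : IsAvg ρ σ f) (hg : IsAvg ρ σ g) :
    IsAvg ρ σ (f + g) := by
  obtain ⟨h, rfl⟩ := hf
  obtain ⟨h', rfl⟩ := hg
  exact ⟨_, (avg_add h h').symm⟩

lemma IsAvg.sub {f g : X →ₗ[k] Y} (hf : IsAvg ρ σ f) (hg : IsAvg ρ σ g) :
    IsAvg ρ σ (f - g) := by
  obtain ⟨h, rfl⟩ := hf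
  obtain ⟨h', rfl⟩ := hg
  exact ⟨_, (avg_sub h h').symm⟩

lemma IsAvg.smul {f : X →ₗ[k] Y} (c : k) (hf : IsAvg ρ σ f) : IsAvg ρ σ (c • f) := by
  obtain ⟨h, rfl⟩ := hf
  exact ⟨_, (avg_smul c h).symm⟩

/-- The representative of the coset of `y`, divided out of `y`. -/
noncomputable def cosetPart (P : Subgroup Q) (y : Q) : P :=
  ⟨(y : Q ⧸ P).out⁻¹ * y, QuotientGroup.eq.mp (QuotientGroup.out_eq' (y : Q ⧸ P))⟩

omit [Fintype Q] in
lemma out_mul_cosetPart (P : Subgroup Q) (y : Q) : (y : Q ⧸ P).out * cosetPart P y = y := by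
  simp [cosetPart]

omit [Fintype Q] in
lemma cosetPart_mul (P : Subgroup Q) (y : Q) (u : P) :
    cosetPart P (y * u) = cosetPart P y * u := by
  have : ((y * u : Q) : Q ⧸ P) = y := QuotientGroup.eq.mpr (by simp)
  ext
  simp [cosetPart, this, mul_assoc]

omit [Fintype Q] in
lemma cosetPart_out (P : Subgroup Q) (q : Q ⧸ P) : cosetPart P q.out = 1 := by
  ext
  simp [cosetPart]

/-- Every group is the product of a set of coset representatives and the subgroup. -/
noncomputable def cosetEquiv (P : Subgroup Q) : (Q ⧸ P) × P ≃ Q where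
  toFun x := x.1.out * x.2
  invFun y := (y, cosetPart P y)
  left_inv x := by
    have : ((x.1.out * x.2 : Q) : Q ⧸ P) = x.1 :=
      (QuotientGroup.eq.mpr (by simp)).trans (QuotientGroup.out_eq' x.1)
    ext1
    · exact this
    · simp [cosetPart_mul, cosetPart_out]
  right_inv y := out_mul_cosetPart P y

lemma sum_cosets {M : Type} [AddCommMonoid M] (P : Subgroup Q) [Fintype P] [Fintype (Q ⧸ P)]
    (F : Q → M) : ∑ g, F g = ∑ q : Q ⧸ P, ∑ u : P, F (q.out * u) := by
  rw [← Fintype.sum_prod_type', ← (cosetEquiv P).sum_comp F]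
  rfl

lemma sum_cosets' {M : Type} [AddCommMonoid M] (P : Subgroup Q) [Fintype P] [Fintype (Q ⧸ P)]
    (F : Q → M) : ∑ g, F g = ∑ q : Q ⧸ P, ∑ u : P, F (u * q.out⁻¹) := by
  rw [← Equiv.sum_comp (Equiv.inv Q) F, sum_cosets P]
  refine Finset.sum_congr rfl fun q _ => ?_
  rw [← Equiv.sum_comp (Equiv.inv P)]
  simp

lemma IsAvg.res {f : X →ₗ[k] Y} (P : Subgroup Q) [Fintype P] (hf : IsAvg ρ σ f) :
    IsAvg (ρ.comp P.subtype) (σ.comp P.subtype) f := by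
  classical
  obtain ⟨h, rfl⟩ := hf
  have := Fintype.ofFinite (Q ⧸ P)
  refine ⟨∑ q : Q ⧸ P, σ q.out⁻¹ ∘ₗ h ∘ₗ ρ q.out, ?_⟩
  ext x
  rw [avg_apply, avg_apply, sum_cosets' P, Finset.sum_comm]
  simp

end Averaging

section PGroup

variable {k Q : Type} [Field k] [Group Q]
variable {X Y Z : Type} [AddCommGroup X] [Module k X] [AddCommGroup Y] [Module k Y]
  [AddCommGroup Z] [Module k Z]

/-- The coinduced representation of functions `Q → Z`. -/
def funRep (k Q Z : Type) [Field k] [Group Q] [AddCommGroup Z] [Module k Z] :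
    Representation k Q (Q → Z) where
  toFun g := LinearMap.funLeft k Z (· * g)
  map_one' := by ext; simp [LinearMap.funLeft]
  map_mul' g h := by
    refine LinearMap.ext fun F => ?_
    ext y
    simp [LinearMap.funLeft, mul_assoc]

@[simp] lemma funRep_apply (g : Q) (F : Q → Z) (y : Q) : funRep k Q Z g F y = F (y * g) := rfl

/-- Evaluation at the identity followed by the inclusion at the identity. -/
noncomputable def unitProj (k Q Z : Type) [Field k] [Group Q] [AddCommGroup Z] [Module k Z]
    [DecidableEq Q] : (Q → Z) →ₗ[k] (Q → Z) :=
  LinearMap.single k (fun _ : Q => Z) 1 ∘ₗ LinearMap.proj 1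

lemma avg_unitProj [Fintype Q] [DecidableEq Q] :
    avg (funRep k Q Z) (funRep k Q Z) (unitProj k Q Z) = LinearMap.id := by
  refine LinearMap.ext fun F => ?_
  ext y
  rw [avg_apply, Finset.sum_apply, Finset.sum_eq_single y⁻¹]
  · simp [unitProj]
  · intro u _ hu
    have : y * u ≠ 1 := fun h => hu (eq_inv_of_mul_eq_one_right h)
    simp [unitProj, this]
  · simp

/-- The map to a coinduced representation adjoint to a linear map. -/
def coindUnit (ρ : Representation k Q X) (h : X →ₗ[k] Y) : X →ₗ[k] (Q → Y) :=
  LinearMap.pi fun g => h ∘ₗ ρ g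

@[simp] lemma coindUnit_apply (ρ : Representation k Q X) (h : X →ₗ[k] Y) (x : X) (g : Q) :
    coindUnit ρ h x g = h (ρ g x) := rfl

lemma coindUnit_equi (ρ : Representation k Q X) (h : X →ₗ[k] Y) :
    Equi ρ (funRep k Q Y) (coindUnit ρ h) := fun u x => by
  ext y
  simp

/-- The canonical map from a coinduced representation. -/
noncomputable def coindCounit [Fintype Q] (σ : Representation k Q Y) : (Q → Y) →ₗ[k] Y :=
  ∑ g, σ g⁻¹ ∘ₗ LinearMap.proj g

lemma coindCounit_apply [Fintype Q] (σ : Representation k Q Y) (F : Q → Y) :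
    coindCounit σ F = ∑ g, σ g⁻¹ (F g) := by
  simp [coindCounit]

lemma coindCounit_equi [Fintype Q] (σ : Representation k Q Y) :
    Equi (funRep k Q Y) σ (coindCounit σ) := fun v F => by
  rw [coindCounit_apply, coindCounit_apply, map_sum]
  refine Fintype.sum_equiv (Equiv.mulRight v) _ _ fun u => ?_
  simp [← Module.End.mul_apply, ← map_mul]

lemma coindCounit_coindUnit [Fintype Q] (ρ : Representation k Q X) (σ : Representation k Q Y)
    (h : X →ₗ[k] Y) (x : X) : coindCounit σ (coindUnit ρ h x) = avg ρ σ h x := by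
  rw [coindCounit_apply, avg_apply, ← Equiv.sum_comp (Equiv.inv Q)]
  simp

/-- A nonzero stable subspace of a representation of a `p`-group in characteristic `p`
contains a nonzero invariant vector. -/
lemma exists_invariant {p : ℕ} [hp : Fact p.Prime] [CharP k p] [Finite Q] (hQ : IsPGroup p Q)
    (ρ : Representation k Q X) (W : Submodule k X) (hW : ∀ u, ∀ x ∈ W, ρ u x ∈ W)
    (hne : W ≠ ⊥) : ∃ x ∈ W, x ≠ 0 ∧ ∀ u, ρ u x = x := by
  obtain ⟨x, hx, hx0⟩ := W.ne_bot_iff.mp hne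
  have hpX : ∀ y : X, p • y = 0 := fun y => by
    rw [← Nat.cast_smul_eq_nsmul k, CharP.cast_eq_zero, zero_smul]
  set S : AddSubgroup X := AddSubgroup.closure (Set.range fun u => ρ u x) with hS
  have hSW : S ≤ W.toAddSubgroup := by
    rw [hS, AddSubgroup.closure_le]
    rintro _ ⟨u, rfl⟩
    exact hW u x hx
  have hSρ : ∀ u, ∀ y ∈ S, ρ u y ∈ S := by
    intro u y hy
    induction hy using AddSubgroup.closure_induction with
    | mem y hy =>
      obtain ⟨v, rfl⟩ := hy
      refine AddSubgroup.subset_closure ⟨u * v, ?_⟩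
      simp
    | zero => simp
    | add a b _ _ ha hb => simpa using S.add_mem ha hb
    | neg a _ ha => simpa using S.neg_mem ha
  have hxS : x ∈ S := AddSubgroup.subset_closure ⟨1, by simp⟩
  have : AddGroup.FG S := by
    rw [AddGroup.fg_iff_addSubgroup_fg]
    exact ⟨(Set.finite_range fun u => ρ u x).toFinset, by simp [hS]⟩
  have : Finite S := by
    refine AddCommGroup.finite_of_fg_isAddTorsion S fun y => ?_
    rw [isOfFinAddOrder_iff_nsmul_eq_zero]
    exact ⟨p, hp.out.pos, Subtype.ext (by simpa using hpX y)⟩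
  let _ : MulAction Q S :=
    { smul := fun u y => ⟨ρ u y, hSρ u y y.2⟩
      one_smul := fun y => Subtype.ext (by change ρ 1 (y : X) = y; simp)
      mul_smul := fun u v y => Subtype.ext (by
        change ρ (u * v) (y : X) = ρ u (ρ v y); simp) }
  have hdvd : p ∣ Nat.card S := by
    have h1 : addOrderOf (⟨x, hxS⟩ : S) = p :=
      addOrderOf_eq_prime (Subtype.ext (by simpa using hpX x))
        (fun h => hx0 (congrArg Subtype.val h))
    exact h1 ▸ addOrderOf_dvd_natCard _
  obtain ⟨b, hb, hb0⟩ := hQ.exists_fixed_point_of_prime_dvd_card_of_fixed_point S hdvd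
    (a := 0) (fun u => Subtype.ext (by change ρ u (0 : X) = 0; simp))
  exact ⟨b, hSW b.2, fun h => hb0 (Subtype.ext h.symm), fun u => congrArg Subtype.val (hb u)⟩

lemma norm_apply [Fintype Q] (ρ : Representation k Q X) (x : X) : ρ.norm x = ∑ u, ρ u x := by
  simp [Representation.norm]

lemma Equi.norm_comm [Fintype Q] {ρ : Representation k Q X} {σ : Representation k Q Y}
    {f : X →ₗ[k] Y} (hf : Equi ρ σ f) (x : X) : f (ρ.norm x) = σ.norm (f x) := by
  simp [Representation.norm, hf _ _]

lemma norm_of_avg_invariant [Fintype Q] {ρ : Representation k Q X} {σ : Representation k Q Y}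
    (h : X →ₗ[k] Y) {x : X} (hx : ∀ u, ρ u x = x) : avg ρ σ h x = σ.norm (h x) := by
  simp [avg_apply, hx, Representation.norm]

/-- Splitting off the free part of a representation of a `p`-group. -/
theorem exists_strip {p : ℕ} [hp : Fact p.Prime] [CharP k p] [Fintype Q] (hQ : IsPGroup p Q)
    (ρ : Representation k Q X) [FiniteDimensional k X] :
    ∃ e : X →ₗ[k] X, Equi ρ ρ e ∧ (∀ x, e (e x) = e x) ∧ (∀ x, ρ.norm (e x) = 0) ∧
      IsAvg ρ ρ (LinearMap.id - e) ∧
      Module.finrank k X = Module.finrank k (LinearMap.range e) +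
        Nat.card Q * Module.finrank k (LinearMap.range ρ.norm) := by
  classical
  obtain ⟨t, ht⟩ := ρ.norm.rangeRestrict.exists_rightInverse_of_surjective
    (LinearMap.range_rangeRestrict _)
  have ht' (z : LinearMap.range ρ.norm) : ρ.norm (t z) = z :=
    congrArg Subtype.val (LinearMap.congr_fun ht z)
  let j : (Q → LinearMap.range ρ.norm) →ₗ[k] X :=
    ∑ u, ρ u⁻¹ ∘ₗ t ∘ₗ LinearMap.proj u
  have hj (F) : j F = ∑ u, ρ u⁻¹ (t (F u)) := by simp [j]
  have hje : Equi (funRep k Q _) ρ j := fun v F => by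
    rw [hj, hj, map_sum]
    refine Fintype.sum_equiv (Equiv.mulRight v) _ _ fun u => ?_
    simp [← Module.End.mul_apply, ← map_mul]
  have hjc (z : LinearMap.range ρ.norm) : j (fun _ => z) = z := by
    rw [hj, ← ht' z, norm_apply]
    exact Equiv.sum_comp (Equiv.inv Q) fun u => ρ u (t _)
  have hinj : LinearMap.ker j = ⊥ := by
    by_contra hne
    obtain ⟨F, hF, hF0, hinv⟩ := exists_invariant hQ (funRep k Q _) (LinearMap.ker j)
      (fun u F hF => by
        rw [LinearMap.mem_ker] at hF ⊢
        rw [hje, hF, map_zero]) hne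
    have hFc : F = fun _ => F 1 := by
      ext1 y
      have := congrFun (hinv y) 1
      simpa using this
    rw [LinearMap.mem_ker, hFc, hjc] at hF
    apply hF0
    rw [hFc]
    ext y
    simpa using hF
  obtain ⟨r, hr⟩ := j.exists_leftInverse_of_injective hinj
  set π := avg ρ (funRep k Q (LinearMap.range ρ.norm)) (unitProj k Q _ ∘ₗ r) with hπ
  have hπj : π ∘ₗ j = LinearMap.id := by
    rw [hπ, avg_comp hje, LinearMap.comp_assoc, hr, LinearMap.comp_id, avg_unitProj]
  have hπj' (F) : π (j F) = F := LinearMap.congr_fun hπj F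
  have hee : Equi ρ ρ (LinearMap.id - j ∘ₗ π) := Equi.id.sub (hje.comp (avg_equi _))
  refine ⟨LinearMap.id - j ∘ₗ π, hee, fun x => ?_, fun x => ?_, ?_, ?_⟩
  · simp [hπj']
  · rw [← hee.norm_comm, show ρ.norm x = j fun _ => ⟨ρ.norm x, x, rfl⟩ from (hjc ⟨_, x, rfl⟩).symm]
    simp [hπj']
  · rw [sub_sub_cancel]
    exact ⟨_, comp_avg hje _⟩
  · rw [← LinearMap.finrank_range_add_finrank_ker (LinearMap.id - j ∘ₗ π)]
    congr 1
    have : LinearMap.ker (LinearMap.id - j ∘ₗ π) = LinearMap.range j := by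
      ext x
      constructor
      · intro hx
        exact ⟨π x, (sub_eq_zero.mp (LinearMap.mem_ker.mp hx)).symm⟩
      · rintro ⟨F, rfl⟩
        simp [hπj']
    rw [this, LinearMap.finrank_range_of_inj (LinearMap.ker_eq_bot.mp hinj),
      Module.finrank_pi_fintype]
    simp

/-- The dimension of a projective representation of a `p`-group is divisible by the order. -/
lemma card_dvd_finrank {p : ℕ} [hp : Fact p.Prime] [CharP k p] [Fintype Q] (hQ : IsPGroup p Q)
    {ρ : Representation k Q X} [FiniteDimensional k X] (h : IsAvg ρ ρ LinearMap.id) :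
    Nat.card Q ∣ Module.finrank k X := by
  obtain ⟨e, hee, he, hN, -, hdim⟩ := exists_strip hQ ρ
  have he0 : e = 0 := by
    obtain ⟨h, hh⟩ := h
    by_contra hne
    obtain ⟨x, ⟨x', hx'⟩, hx0, hinv⟩ := exists_invariant hQ ρ (LinearMap.range e)
      (by rintro u _ ⟨x, rfl⟩; exact ⟨ρ u x, hee u x⟩)
      (fun h => hne (LinearMap.range_eq_bot.mp h))
    apply hx0
    have h1 : x = ρ.norm (h x) := by
      rw [← norm_of_avg_invariant h hinv, ← hh, LinearMap.id_apply]
    have h2 : e x = x := by rw [← hx', he]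
    rw [← h2, h1, hee.norm_comm, hN]
  have : Module.finrank k (LinearMap.range e) = 0 := by rw [he0, LinearMap.range_zero]; simp
  rw [hdim, this, zero_add]
  exact dvd_mul_right _ _

end PGroup

section Shift

variable {k Q : Type} [Field k] [Group Q] [Fintype Q]
variable {X Y R : Type} [AddCommGroup X] [Module k X] [AddCommGroup Y] [Module k Y]
  [AddCommGroup R] [Module k R]
variable {ρX : Representation k Q X} {ρY : Representation k Q Y} {ρR : Representation k Q R}

/-- Every stable endomorphism is a scalar. -/
def StablyScalar (ρ : Representation k Q X) : Prop :=
  ∀ u, Equi ρ ρ u → ∃ c : k, IsAvg ρ ρ (u - c • LinearMap.id)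

lemma StablyScalar.kernel {i : Y →ₗ[k] R} {q : R →ₗ[k] X} (hi : Equi ρY ρR i)
    (hq : Equi ρR ρX q) (inj : Function.Injective i) (surj : Function.Surjective q)
    (exact : ∀ y, q y = 0 ↔ ∃ x, i x = y) (hR : IsAvg ρR ρR LinearMap.id)
    (hX : StablyScalar ρX) : StablyScalar ρY := by
  intro u hu
  obtain ⟨h, hh⟩ := hR
  obtain ⟨r, hr⟩ := i.exists_leftInverse_of_injective (LinearMap.ker_eq_bot.mpr inj)
  obtain ⟨s, hs⟩ := q.exists_rightInverse_of_surjective (LinearMap.range_eq_top.mpr surj)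
  have hr' (y) : r (i y) = y := LinearMap.congr_fun hr y
  have hs' (x) : q (s x) = x := LinearMap.congr_fun hs x
  have hqi (y) : q (i y) = 0 := (exact _).mpr ⟨y, rfl⟩
  set U := avg ρR ρR (h ∘ₗ i ∘ₗ u ∘ₗ r) with hU
  have hUe : Equi ρR ρR U := avg_equi _
  have hUi : U ∘ₗ i = i ∘ₗ u := by
    rw [hU, avg_comp hi]
    simp only [LinearMap.comp_assoc]
    rw [hr, LinearMap.comp_id, ← avg_comp (hi.comp hu), ← hh, LinearMap.id_comp]
  have hUi' (y) : U (i y) = i (u y) := LinearMap.congr_fun hUi y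
  set v := q ∘ₗ U ∘ₗ s with hv
  have hvq (x) : v (q x) = q (U x) := by
    obtain ⟨y, hy⟩ := (exact (s (q x) - x)).mp (by simp [hs'])
    have : s (q x) = x + i y := by rw [hy]; abel
    simp [hv, this, hUi', hqi]
  have hve : Equi ρX ρX v := fun g x => by
    obtain ⟨x, rfl⟩ := surj x
    rw [← hq, hvq, hvq, hUe, hq]
  obtain ⟨c, h', hh'⟩ := hX v hve
  set w' := U - c • LinearMap.id - avg ρR ρR (s ∘ₗ h' ∘ₗ q) with hw'
  have hw'e : Equi ρR ρR w' := (hUe.sub (Equi.id.smul c)).sub (avg_equi _)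
  have hqw (x) : q (w' x) = 0 := by
    have h1 : q ∘ₗ avg ρR ρR (s ∘ₗ h' ∘ₗ q) = (v - c • LinearMap.id) ∘ₗ q := by
      rw [comp_avg hq, ← LinearMap.comp_assoc, hs, LinearMap.id_comp, hh', avg_comp hq]
    have h2 := LinearMap.congr_fun h1 x
    simp only [LinearMap.comp_apply] at h2
    simp [hw', h2, hvq]
  have hiw (x) : i (r (w' x)) = w' x := by
    obtain ⟨y, hy⟩ := (exact _).mp (hqw x)
    rw [← hy, hr']
  have hwe : Equi ρR ρY (r ∘ₗ w') := fun g x => inj (by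
    simp only [LinearMap.comp_apply]
    rw [hi, hiw, hiw, hw'e])
  refine ⟨c, (r ∘ₗ w') ∘ₗ h ∘ₗ i, ?_⟩
  rw [← comp_avg hwe, ← avg_comp hi, ← hh, LinearMap.id_comp]
  have h0 : avg ρR ρR (s ∘ₗ h' ∘ₗ q) ∘ₗ i = 0 := by
    rw [avg_comp hi]
    have : (s ∘ₗ h' ∘ₗ q) ∘ₗ i = 0 := by ext y; simp [hqi]
    rw [this]; ext; simp [avg_apply]
  have h0' (y) := LinearMap.congr_fun h0 y
  ext y
  apply inj
  simp only [LinearMap.comp_apply] at h0' ⊢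
  rw [hiw]
  simp [hw', h0', hUi']

lemma StablyScalar.cokernel {i : Y →ₗ[k] R} {q : R →ₗ[k] X} (hi : Equi ρY ρR i)
    (hq : Equi ρR ρX q) (inj : Function.Injective i) (surj : Function.Surjective q)
    (exact : ∀ y, q y = 0 ↔ ∃ x, i x = y) (hR : IsAvg ρR ρR LinearMap.id)
    (hY : StablyScalar ρY) : StablyScalar ρX := by
  intro u hu
  obtain ⟨h, hh⟩ := hR
  obtain ⟨r, hr⟩ := i.exists_leftInverse_of_injective (LinearMap.ker_eq_bot.mpr inj)
  obtain ⟨s, hs⟩ := q.exists_rightInverse_of_surjective (LinearMap.range_eq_top.mpr surj)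
  have hr' (y) : r (i y) = y := LinearMap.congr_fun hr y
  have hs' (x) : q (s x) = x := LinearMap.congr_fun hs x
  have hqi (y) : q (i y) = 0 := (exact _).mpr ⟨y, rfl⟩
  set U := avg ρR ρR (s ∘ₗ u ∘ₗ q ∘ₗ h) with hU
  have hUe : Equi ρR ρR U := avg_equi _
  have hqU : q ∘ₗ U = u ∘ₗ q := by
    rw [hU, comp_avg hq, ← LinearMap.comp_assoc, hs, LinearMap.id_comp, ← LinearMap.comp_assoc,
      ← comp_avg (hu.comp hq), ← hh, LinearMap.comp_id]
  have hqU' (x) : q (U x) = u (q x) := LinearMap.congr_fun hqU x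
  have hiU (y) : i (r (U (i y))) = U (i y) := by
    obtain ⟨z, hz⟩ := (exact (U (i y))).mp (by rw [hqU', hqi, map_zero])
    rw [← hz, hr']
  have hue : Equi ρY ρY (r ∘ₗ U ∘ₗ i) := fun g x => inj (by
    simp only [LinearMap.comp_apply]
    rw [hiU, hi, hi, hiU, hUe])
  obtain ⟨c, h', hh'⟩ := hY _ hue
  set v := U - c • LinearMap.id - avg ρR ρR (i ∘ₗ h' ∘ₗ r) with hv
  have hve : Equi ρR ρR v := (hUe.sub (Equi.id.smul c)).sub (avg_equi _)
  have hvi (y) : v (i y) = 0 := by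
    have h1 : avg ρR ρR (i ∘ₗ h' ∘ₗ r) ∘ₗ i = i ∘ₗ (r ∘ₗ U ∘ₗ i - c • LinearMap.id) := by
      rw [avg_comp hi, LinearMap.comp_assoc, LinearMap.comp_assoc, hr, LinearMap.comp_id, hh',
        comp_avg hi]
    have h2 := LinearMap.congr_fun h1 y
    simp only [LinearMap.comp_apply] at h2
    simp [hv, h2, hiU]
  have hvs (x) : v (s (q x)) = v x := by
    obtain ⟨y, hy⟩ := (exact (s (q x) - x)).mp (by simp [hs'])
    have : s (q x) = x + i y := by rw [hy]; abel
    rw [this, map_add, hvi, add_zero]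
  have hwe : Equi ρX ρR (v ∘ₗ s) := fun g x => by
    obtain ⟨x, rfl⟩ := surj x
    simp only [LinearMap.comp_apply]
    rw [← hq, hvs, hvs, hve]
  refine ⟨c, q ∘ₗ h ∘ₗ v ∘ₗ s, ?_⟩
  rw [← comp_avg hq, ← avg_comp hwe, ← hh, LinearMap.id_comp]
  have h0 : q ∘ₗ avg ρR ρR (i ∘ₗ h' ∘ₗ r) = 0 := by
    rw [comp_avg hq]
    have : q ∘ₗ i ∘ₗ h' ∘ₗ r = 0 := by ext y; simp [hqi]
    rw [this]; ext; simp [avg_apply]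
  have h0' (y) := LinearMap.congr_fun h0 y
  ext x
  obtain ⟨x, rfl⟩ := surj x
  simp only [LinearMap.comp_apply] at h0' ⊢
  rw [hvs]
  simp [hv, h0', hqU']

end Shift

section Bridge

variable {k G : Type} [Field k] [Group G]
variable {X Y : Type} [AddCommGroup X] [Module k X] [Module (MonoidAlgebra k G) X]
  [IsScalarTower k (MonoidAlgebra k G) X]
  [AddCommGroup Y] [Module k Y] [Module (MonoidAlgebra k G) Y]
  [IsScalarTower k (MonoidAlgebra k G) Y]

/-- The representation underlying a module over the group algebra. -/
noncomputable abbrev rep (k G X : Type) [Field k] [Group G] [AddCommGroup X] [Module k X]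
    [Module (MonoidAlgebra k G) X] [IsScalarTower k (MonoidAlgebra k G) X] :
    Representation k G X := Representation.ofModule' X

lemma rep_apply (g : G) (x : X) : rep k G X g x = MonoidAlgebra.single g (1 : k) • x := by
  simp [rep, Representation.ofModule']

lemma equi_restrictScalars (f : X →ₗ[MonoidAlgebra k G] Y) :
    Equi (rep k G X) (rep k G Y) (f.restrictScalars k) := fun u x => by
  simp [rep_apply]

/-- The module map given by an equivariant linear map. -/
noncomputable def Equi.toHom {f : X →ₗ[k] Y} (hf : Equi (rep k G X) (rep k G Y) f) :
    X →ₗ[MonoidAlgebra k G] Y :=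
  MonoidAlgebra.equivariantOfLinearOfComm f fun g v => by
    simpa only [rep_apply] using hf g v

@[simp] lemma Equi.toHom_apply {f : X →ₗ[k] Y} (hf : Equi (rep k G X) (rep k G Y) f) (x : X) :
    hf.toHom x = f x := rfl

omit [Module (MonoidAlgebra k G) Y] [IsScalarTower k (MonoidAlgebra k G) Y] in
lemma rep_asModule (ρ : Representation k G Y) : rep k G ρ.asModule = ρ := by
  refine MonoidHom.ext fun g => LinearMap.ext fun x => ?_
  rw [rep_apply]
  exact LinearMap.congr_fun (ρ.asAlgebraHom_single_one g) x

variable [Fintype G]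

lemma projective_of_isAvg (h : IsAvg (rep k G X) (rep k G X) LinearMap.id) :
    Module.Projective (MonoidAlgebra k G) X := by
  obtain ⟨h, hh⟩ := h
  refine .of_lifting_property'' fun f hf => ?_
  obtain ⟨s, hs⟩ := (f.restrictScalars k).exists_rightInverse_of_surjective
    (LinearMap.range_eq_top.mpr hf)
  refine ⟨(avg_equi (s ∘ₗ h)).toHom, LinearMap.ext fun x => ?_⟩
  have := LinearMap.congr_fun (comp_avg (ρ := rep k G X) (equi_restrictScalars f) (s ∘ₗ h)) x
  rw [← LinearMap.comp_assoc, hs, LinearMap.id_comp, ← hh] at this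
  exact this

lemma isAvg_of_projective [Module.Projective (MonoidAlgebra k G) X] :
    IsAvg (rep k G X) (rep k G X) LinearMap.id := by
  classical
  obtain ⟨s, hs⟩ := Module.projective_def'.mp
    (inferInstance : Module.Projective (MonoidAlgebra k G) X)
  let c : MonoidAlgebra k G →ₗ[k] MonoidAlgebra k G :=
    { toFun := fun a => MonoidAlgebra.single 1 (a.coeff 1)
      map_add' := fun a b => by simp
      map_smul' := fun r a => by simp }
  have hca (a : MonoidAlgebra k G) : c a = MonoidAlgebra.single 1 (a.coeff 1) := rfl
  have hc : avg (rep k G (MonoidAlgebra k G)) (rep k G (MonoidAlgebra k G)) c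
      = LinearMap.id := by
    refine LinearMap.ext fun a => ?_
    rw [avg_apply]
    simp only [rep_apply, smul_eq_mul, LinearMap.id_apply]
    have (x : G) : c (MonoidAlgebra.single x⁻¹ 1 * a) = MonoidAlgebra.single 1 (a.coeff x) := by
      rw [hca]
      simp
    ext g
    simp [this]
  have hF : IsAvg (rep k G (X →₀ MonoidAlgebra k G)) (rep k G (X →₀ MonoidAlgebra k G))
      LinearMap.id := by
    refine ⟨Finsupp.mapRange.linearMap c, ?_⟩
    refine LinearMap.ext fun F => Finsupp.ext fun x => ?_
    have := LinearMap.congr_fun hc (F x)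
    rw [avg_apply] at this ⊢
    rw [Finsupp.finsetSum_apply]
    simp only [rep_apply] at this ⊢
    exact this.symm
  have := (hF.comp_right (equi_restrictScalars s)).comp_left
    (equi_restrictScalars (Finsupp.linearCombination (MonoidAlgebra k G) (id : X → X)))
  convert this
  exact LinearMap.ext fun x => (LinearMap.congr_fun hs x).symm

lemma stablyZero_iff (f : ModuleCat.of (MonoidAlgebra k G) X ⟶ ModuleCat.of (MonoidAlgebra k G) Y) :
    StablyZero f ↔ IsAvg (rep k G X) (rep k G Y) (f.hom.restrictScalars k) := by
  constructor
  · rintro ⟨R, hR, g, h, rfl⟩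
    let _ : Module k R := Module.compHom R (algebraMap k (MonoidAlgebra k G))
    have : IsScalarTower k (MonoidAlgebra k G) R := ⟨fun a b c => by
      change (a • b) • c = algebraMap k (MonoidAlgebra k G) a • b • c
      rw [Algebra.smul_def, mul_smul]⟩
    have : Module.Projective (MonoidAlgebra k G) R :=
      (IsProjective.iff_projective _).mpr hR
    exact ((isAvg_of_projective (k := k) (G := G) (X := R)).comp_right
      (equi_restrictScalars g.hom)).comp_left (equi_restrictScalars h.hom)
  · classical
    rintro ⟨h, hh⟩
    let R := (funRep k G Y).asModule
    have hR : rep k G R = funRep k G Y := rep_asModule _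
    have hproj : Module.Projective (MonoidAlgebra k G) R := by
      apply projective_of_isAvg
      rw [hR]
      exact ⟨_, avg_unitProj.symm⟩
    let ι : X →ₗ[k] R := coindUnit (rep k G X) h
    let ε : R →ₗ[k] Y := coindCounit (rep k G Y)
    have hι : Equi (rep k G X) (rep k G R) ι := by
      rw [hR]
      exact coindUnit_equi _ _
    have hε : Equi (rep k G R) (rep k G Y) ε := by
      rw [hR]
      exact coindCounit_equi _
    refine ⟨ModuleCat.of _ R, (IsProjective.iff_projective _).mp hproj,
      ModuleCat.ofHom hι.toHom, ModuleCat.ofHom hε.toHom, ?_⟩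
    ext x
    exact (LinearMap.congr_fun hh x).trans (coindCounit_coindUnit _ _ h x).symm

end Bridge

section Syzygy

variable {k Q : Type} [Field k] [Group Q]
variable {X Y R : Type} [AddCommGroup X] [Module k X] [AddCommGroup Y] [Module k Y]
  [AddCommGroup R] [Module k R]

lemma finiteDimensional_of_exact [FiniteDimensional k X] [FiniteDimensional k Y]
    (i : Y →ₗ[k] R) (q : R →ₗ[k] X) (exact : ∀ y, q y = 0 ↔ ∃ x, i x = y) :
    FiniteDimensional k R := by
  have h : LinearMap.ker q = LinearMap.range i := by
    ext y
    exact exact y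
  have : Module.Finite k (LinearMap.ker q) := by rw [h]; infer_instance
  have : Module.Finite k (R ⧸ LinearMap.ker q) := .equiv q.quotKerEquivRange.symm
  exact .of_submodule_quotient (LinearMap.ker q)

lemma finrank_of_exact [FiniteDimensional k R]
    (i : Y →ₗ[k] R) (q : R →ₗ[k] X) (inj : Function.Injective i) (surj : Function.Surjective q)
    (exact : ∀ y, q y = 0 ↔ ∃ x, i x = y) :
    Module.finrank k R = Module.finrank k X + Module.finrank k Y := by
  have h : LinearMap.ker q = LinearMap.range i := by
    ext y
    exact exact y
  rw [← LinearMap.finrank_range_add_finrank_ker q, h, LinearMap.finrank_range_of_inj inj,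
    LinearMap.range_eq_top.mpr surj, finrank_top]

variable [Fintype Q]

lemma avg_trivial_eq_zero {p : ℕ} [CharP k p] (hp : p ∣ Nat.card Q) (h : k →ₗ[k] k) :
    avg (Representation.trivial k Q k) (Representation.trivial k Q k) h = 0 := by
  refine LinearMap.ext fun x => ?_
  rw [avg_apply]
  have : ((Fintype.card Q : ℕ) : k) = 0 := by
    rw [CharP.cast_eq_zero_iff k p, ← Nat.card_eq_fintype_card]
    exact hp
  simp [this]

/-- Data of a stable isomorphism with the trivial representation. -/
lemma stablyScalar_of_stablyIso {p : ℕ} [hp : Fact p.Prime] [CharP k p] (hQ : IsPGroup p Q)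
    (hpQ : p ∣ Nat.card Q) {ρ : Representation k Q X} [FiniteDimensional k X]
    {f : X →ₗ[k] k} {g : k →ₗ[k] X} (hf : Equi ρ (Representation.trivial k Q k) f)
    (hg : Equi (Representation.trivial k Q k) ρ g)
    (hgf : IsAvg ρ ρ (g ∘ₗ f - LinearMap.id))
    (hfg : IsAvg (Representation.trivial k Q k) (Representation.trivial k Q k)
      (f ∘ₗ g - LinearMap.id)) :
    StablyScalar ρ ∧ (Nat.card Q : ℤ) ∣ Module.finrank k X - 1 := by
  have hfg1 : f ∘ₗ g = LinearMap.id := by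
    obtain ⟨h, hh⟩ := hfg
    rwa [avg_trivial_eq_zero hpQ, sub_eq_zero] at hh
  have hfg1' (t) : f (g t) = t := LinearMap.congr_fun hfg1 t
  constructor
  · intro u hu
    refine ⟨f (u (g 1)), ?_⟩
    have h1 : g ∘ₗ f ∘ₗ u ∘ₗ g ∘ₗ f = f (u (g 1)) • g ∘ₗ f := by
      ext x
      have : f x = f x • 1 := by simp
      rw [LinearMap.comp_apply, LinearMap.comp_apply, LinearMap.comp_apply, LinearMap.comp_apply,
        this, map_smul, map_smul, map_smul, map_smul]
      have : g (f (u (g 1))) = f (u (g 1)) • g 1 := by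
        conv_lhs => rw [← mul_one (f (u (g 1))), ← smul_eq_mul, map_smul]
      rw [this, LinearMap.smul_apply, LinearMap.comp_apply, smul_comm, ← map_smul g]
      simp
    have e : u - f (u (g 1)) • LinearMap.id = f (u (g 1)) • (g ∘ₗ f - LinearMap.id)
        - (g ∘ₗ f - LinearMap.id) ∘ₗ u
        - ((g ∘ₗ f) ∘ₗ u) ∘ₗ (g ∘ₗ f - LinearMap.id) := by
      have h1' (x) := LinearMap.congr_fun h1 x
      ext x
      simp only [LinearMap.comp_apply] at h1'
      simp [h1', smul_sub]
      abel
    rw [e]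
    exact ((hgf.smul _).sub (hgf.comp_right hu)).sub (hgf.comp_left ((hg.comp hf).comp hu))
  · have hW : ∀ u, LinearMap.ker f ≤ (LinearMap.ker f).comap (ρ u) := fun u x hx => by
      rw [Submodule.mem_comap, LinearMap.mem_ker, hf, LinearMap.mem_ker.mp hx, map_zero]
    have hinc : Equi (ρ.subrepresentation (LinearMap.ker f) hW) ρ (LinearMap.ker f).subtype :=
      fun u x => rfl
    let pr : X →ₗ[k] LinearMap.ker f := (LinearMap.id - g ∘ₗ f).codRestrict _ fun x => by
      simp [hfg1']
    have hpr : Equi ρ (ρ.subrepresentation (LinearMap.ker f) hW) pr := fun u x => by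
      ext
      have : g (f x) = ρ u (g (f x)) := hg u (f x)
      simp [pr, hf u x, ← this]
    have hK : IsAvg (ρ.subrepresentation (LinearMap.ker f) hW)
        (ρ.subrepresentation (LinearMap.ker f) hW) LinearMap.id := by
      have := ((hgf.comp_right hinc).comp_left hpr).smul (-1)
      convert this
      ext x
      have hx : f x = 0 := x.2
      simp [pr, hx]
    have hd := card_dvd_finrank hQ hK
    have := LinearMap.finrank_range_add_finrank_ker f
    have hs : LinearMap.range f = ⊤ := LinearMap.range_eq_top.mpr fun t => ⟨g t, hfg1' t⟩
    rw [hs, finrank_top, Module.finrank_self] at this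
    rw [← this]
    push_cast
    rw [add_sub_cancel_left]
    exact_mod_cast hd

/-- The dimension is congruent to one or minus one. -/
def DimUnit (q n : ℕ) : Prop := (q : ℤ) ∣ n - 1 ∨ (q : ℤ) ∣ n + 1

lemma DimUnit.of_add {q n m : ℕ} (h : q ∣ n + m) (hn : DimUnit q n) : DimUnit q m := by
  have h' : (q : ℤ) ∣ n + m := by exact_mod_cast h
  rcases hn with hn | hn
  · right
    have := h'.sub hn
    ring_nf at this ⊢
    exact this
  · left
    have := h'.sub hn
    ring_nf at this ⊢
    exact this

end Syzygy

section Family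

variable {k G : Type} [Field k] [Group G] [Fintype G]

/-- A scalar multiplication by the ground field on a module over the group algebra. -/
noncomputable abbrev groundModule (k G : Type) [Field k] [Group G]
    (M : ModuleCat (MonoidAlgebra k G)) : Module k M :=
  Module.compHom M (algebraMap k (MonoidAlgebra k G))

omit [Fintype G] in
lemma groundModule_tower (M : ModuleCat (MonoidAlgebra k G)) :
    letI := groundModule k G M
    IsScalarTower k (MonoidAlgebra k G) M := by
  let _ := groundModule k G M
  exact ⟨fun a b c => by
      change (a • b) • c = algebraMap k (MonoidAlgebra k G) a • b • c
      rw [Algebra.smul_def, mul_smul]⟩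

/-- The restriction of the representation underlying a module to a subgroup. -/
noncomputable abbrev resRep (P : Subgroup G) (X : Type) [AddCommGroup X] [Module k X]
    [Module (MonoidAlgebra k G) X] [IsScalarTower k (MonoidAlgebra k G) X] :
    Representation k P X := (rep k G X).comp P.subtype

theorem syzygy_stablyScalar {p : ℕ} [hp : Fact p.Prime] [CharP k p] (P : Subgroup G) [Fintype P]
    (hP : IsPGroup p P) (hpP : p ∣ Nat.card P)
    (Ωk : ℤ → ModuleCat (MonoidAlgebra k G)) (hΩk : IsSyzygyFamily (triv k G) Ωk) (i : ℤ) :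
    ∀ [Module k (Ωk i)] [IsScalarTower k (MonoidAlgebra k G) (Ωk i)],
      FiniteDimensional k (Ωk i) ∧ StablyScalar (resRep (k := k) P (Ωk i)) ∧
        DimUnit (Nat.card P) (Module.finrank k (Ωk i)) := by
  obtain ⟨hfin, hbase, hstep⟩ := hΩk
  have hfd (i) [Module k (Ωk i)] [IsScalarTower k (MonoidAlgebra k G) (Ωk i)] :
      FiniteDimensional k (Ωk i) := by
    have := hfin i
    exact Module.Finite.trans (MonoidAlgebra k G) (Ωk i)
  induction i using Int.induction_on with
  | zero =>
    intro _ _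
    have := hfd 0
    refine ⟨this, ?_⟩
    obtain ⟨f, g, hfg, hgf⟩ := hbase
    let T := (Representation.trivial k (G := G) (V := k)).asModule
    have hT : rep k G T = Representation.trivial k (G := G) (V := k) := rep_asModule _
    let f' : Ωk 0 →ₗ[MonoidAlgebra k G] T := f.hom
    let g' : T →ₗ[MonoidAlgebra k G] Ωk 0 := g.hom
    have h1 := ((stablyZero_iff (X := Ωk 0) (Y := Ωk 0) _).mp hfg).res P
    have h2 := ((stablyZero_iff (X := T) (Y := T) _).mp hgf).res P
    have hf := (equi_restrictScalars f').res P
    have hg := (equi_restrictScalars g').res P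
    rw [hT] at h2 hf hg
    obtain ⟨h3, h4⟩ := stablyScalar_of_stablyIso hP hpP (f := f'.restrictScalars k)
      (g := g'.restrictScalars k) hf hg h1 h2
    exact ⟨h3, Or.inl h4⟩
  | succ i ih =>
    intro _ _
    have := hfd (i + 1)
    refine ⟨this, ?_⟩
    let _ := groundModule k G (Ωk i)
    have := groundModule_tower (k := k) (G := G) (Ωk i)
    obtain ⟨_, ih1, ih2⟩ := ih
    obtain ⟨R, hR, ⟨s⟩⟩ := hstep i
    let _ := groundModule k G R
    have := groundModule_tower (k := k) (G := G) R
    have hR' : Module.Projective (MonoidAlgebra k G) R := (IsProjective.iff_projective _).mpr hR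
    have hR1 := (isAvg_of_projective (k := k) (G := G) (X := R)).res P
    have := finiteDimensional_of_exact (s.i.hom.restrictScalars k) (s.p.hom.restrictScalars k)
      s.exact
    refine ⟨ih1.kernel ((equi_restrictScalars s.i.hom).res P)
      ((equi_restrictScalars s.p.hom).res P) s.inj s.surj s.exact hR1, ?_⟩
    refine DimUnit.of_add ?_ ih2
    rw [← finrank_of_exact (s.i.hom.restrictScalars k) (s.p.hom.restrictScalars k) s.inj s.surj
      s.exact]
    exact card_dvd_finrank hP hR1
  | pred i ih =>
    intro _ _
    have := hfd (-i - 1)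
    refine ⟨this, ?_⟩
    let _ := groundModule k G (Ωk (-i))
    have := groundModule_tower (k := k) (G := G) (Ωk (-i))
    obtain ⟨_, ih1, ih2⟩ := ih
    obtain ⟨R, hR, ⟨s⟩⟩ := hstep (-i - 1)
    rw [sub_add_cancel] at s
    let _ := groundModule k G R
    have := groundModule_tower (k := k) (G := G) R
    have hR' : Module.Projective (MonoidAlgebra k G) R := (IsProjective.iff_projective _).mpr hR
    have hR1 := (isAvg_of_projective (k := k) (G := G) (X := R)).res P
    have := finiteDimensional_of_exact (s.i.hom.restrictScalars k) (s.p.hom.restrictScalars k)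
      s.exact
    refine ⟨ih1.cokernel ((equi_restrictScalars s.i.hom).res P)
      ((equi_restrictScalars s.p.hom).res P) s.inj s.surj s.exact hR1, ?_⟩
    refine DimUnit.of_add ?_ ih2
    rw [add_comm, ← finrank_of_exact (s.i.hom.restrictScalars k) (s.p.hom.restrictScalars k)
      s.inj s.surj s.exact]
    exact card_dvd_finrank hP hR1

end Family

section Trace

variable {k : Type} [Field k]
variable {X V : Type} [AddCommGroup X] [Module k X] [AddCommGroup V] [Module k V]

/-- Every functional on linear maps is represented by a trace. -/
lemma exists_trace_eq [FiniteDimensional k X] (Λ : (X →ₗ[k] V) →ₗ[k] k) :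
    ∃ θ : V →ₗ[k] X, ∀ h, Λ h = LinearMap.trace k X (θ ∘ₗ h) := by
  let b := Module.finBasis k X
  refine ⟨∑ i, (Λ ∘ₗ LinearMap.smulRightₗ (b.coord i)).smulRight (b i), fun h => ?_⟩
  have hh : h = ∑ i, (b.coord i).smulRight (h (b i)) := b.ext fun j => by
    simp [Finsupp.single_apply]
  rw [LinearMap.trace_eq_matrix_trace k b, Matrix.trace]
  conv_lhs => rw [hh]
  simp [LinearMap.toMatrix_apply, Finsupp.single_apply]

lemma trace_comp_smulRight [FiniteDimensional k X] (A : V →ₗ[k] X) (f : X →ₗ[k] k) (v : V) :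
    LinearMap.trace k X (A ∘ₗ f.smulRight v) = f (A v) := by
  have : A ∘ₗ f.smulRight v = f.smulRight (A v) := by
    ext x
    simp
  rw [this]
  simp

lemma eq_zero_of_trace_comp [FiniteDimensional k X] (A : V →ₗ[k] X)
    (h : ∀ B : X →ₗ[k] V, LinearMap.trace k X (A ∘ₗ B) = 0) : A = 0 := by
  ext v
  rw [LinearMap.zero_apply, ← Module.forall_dual_apply_eq_zero_iff k]
  intro f
  rw [← trace_comp_smulRight]
  exact h _

end Trace

section Ghost

variable {k G : Type} [Field k] [Group G]
variable {X V : Type} [AddCommGroup X] [Module k X] [AddCommGroup V] [Module k V]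

/-- The algebra of equivariant endomorphisms. -/
def equiEnd (ρ : Representation k G V) : Subalgebra k (Module.End k V) where
  carrier := {f | Equi ρ ρ f}
  mul_mem' hf hg := Equi.comp hf hg
  one_mem' := Equi.id
  add_mem' hf hg := Equi.add hf hg
  zero_mem' u x := by simp
  algebraMap_mem' c := by
    rw [Module.algebraMap_end_eq_smul_id]
    exact Equi.id.smul c

/-- The left ideal of equivariant endomorphisms that are averages over a subgroup. -/
def avgIdeal (ρ : Representation k G V) (P : Subgroup G) [Fintype P] : Ideal (equiEnd ρ) where
  carrier := {f | IsAvg (ρ.comp P.subtype) (ρ.comp P.subtype) f.1}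
  add_mem' hf hg := IsAvg.add hf hg
  zero_mem' := ⟨0, by ext; simp [avg_apply]⟩
  smul_mem' a f hf := IsAvg.comp_left hf (a.2.res P)

lemma mem_jacobson_avgIdeal {ρ : Representation k G V} {P : Subgroup G} [Fintype P]
    (φ : equiEnd ρ) (h : ∀ y : equiEnd ρ, φ * y * φ ∈ avgIdeal ρ P) :
    φ ∈ (avgIdeal ρ P).jacobson := by
  rw [Ideal.mem_jacobson_iff]
  intro y
  refine ⟨1 - y * φ, ?_⟩
  have : (1 - y * φ) * y * φ + (1 - y * φ) - 1 = -(y * (φ * y * φ)) := by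
    simp only [sub_mul, one_mul, mul_assoc]
    abel
  rw [this]
  exact neg_mem (Ideal.mul_mem_left _ _ (h y))

variable [Fintype G]

theorem exists_separating_endo [FiniteDimensional k V] (ρ : Representation k G V)
    (P : Subgroup G) [Fintype P]
    (hid : ¬ IsAvg (ρ.comp P.subtype) (ρ.comp P.subtype) LinearMap.id) :
    ∃ θ : V →ₗ[k] V, LinearMap.trace k V θ ≠ 0 ∧ avg ρ ρ θ = 0 ∧
      ∀ φ : equiEnd ρ, (∀ y : equiEnd ρ, φ * y * φ ∈ avgIdeal ρ P) →
        LinearMap.trace k V (θ ∘ₗ φ.1) = 0 := by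
  let W : Submodule k (Module.End k V) :=
    ((avgIdeal ρ P).jacobson.restrictScalars k).map (equiEnd ρ).val.toLinearMap
  have hW : (1 : Module.End k V) ∉ W := by
    rintro ⟨φ, hφ, h1⟩
    have h1' : φ = 1 := Subtype.ext h1
    have h2 : (1 : equiEnd ρ) ∈ (avgIdeal ρ P).jacobson := h1' ▸ hφ
    have h3 := (Ideal.eq_top_iff_one _).mpr h2
    rw [Ideal.jacobson_eq_top_iff, Ideal.eq_top_iff_one] at h3
    exact hid h3
  obtain ⟨Λ, hΛ, hWΛ⟩ := Submodule.exists_le_ker_of_notMem hW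
  obtain ⟨θ, hθ⟩ := exists_trace_eq Λ
  have key (φ : equiEnd ρ) (h : ∀ y : equiEnd ρ, φ * y * φ ∈ avgIdeal ρ P) :
      LinearMap.trace k V (θ ∘ₗ φ.1) = 0 := by
    rw [← hθ]
    exact hWΛ ⟨φ, mem_jacobson_avgIdeal φ h, rfl⟩
  refine ⟨θ, ?_, ?_, key⟩
  · rw [hθ] at hΛ
    exact hΛ
  · refine eq_zero_of_trace_comp _ fun h => ?_
    have h1 : LinearMap.trace k V (avg ρ ρ θ ∘ₗ h) = LinearMap.trace k V (θ ∘ₗ avg ρ ρ h) := by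
      have e1 : avg ρ ρ θ ∘ₗ h = ∑ u, ρ u ∘ₗ (θ ∘ₗ ρ u⁻¹ ∘ₗ h) := by
        ext x
        simp [avg_apply]
      have e2 : θ ∘ₗ avg ρ ρ h = ∑ u, (θ ∘ₗ ρ u⁻¹ ∘ₗ h) ∘ₗ ρ u := by
        ext x
        rw [LinearMap.comp_apply, avg_apply, ← Equiv.sum_comp (Equiv.inv G)]
        simp
      rw [e1, e2, map_sum, map_sum]
      exact Finset.sum_congr rfl fun u _ => LinearMap.trace_comp_comm' _ _
    rw [h1]
    refine key ⟨avg ρ ρ h, avg_equi h⟩ fun y => ?_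
    have : IsAvg ρ ρ (avg ρ ρ h) := ⟨h, rfl⟩
    exact (this.comp_right (y.2.comp (avg_equi h))).res P

/-- The kernel of the canonical map from a coinduced representation. -/
noncomputable def omegaRep (ρ : Representation k G V) :
    Representation k G (LinearMap.ker (coindCounit ρ)) :=
  (funRep k G V).subrepresentation _ fun u F hF => by
    rw [Submodule.mem_comap, LinearMap.mem_ker, coindCounit_equi, LinearMap.mem_ker.mp hF, map_zero]

lemma omegaRep_subtype (ρ : Representation k G V) :
    Equi (omegaRep ρ) (funRep k G V) (LinearMap.ker (coindCounit ρ)).subtype := fun _ _ => rfl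

/-- The map to the syzygy given by an endomorphism with vanishing average. -/
noncomputable def omegaMap (ρ : Representation k G V) (θ : V →ₗ[k] V) (hθ : avg ρ ρ θ = 0) :
    V →ₗ[k] LinearMap.ker (coindCounit ρ) :=
  (coindUnit ρ θ).codRestrict _ fun x => by
    rw [LinearMap.mem_ker, coindCounit_coindUnit ρ ρ, hθ, LinearMap.zero_apply]

lemma omegaMap_equi (ρ : Representation k G V) (θ : V →ₗ[k] V) (hθ : avg ρ ρ θ = 0) :
    Equi ρ (omegaRep ρ) (omegaMap ρ θ hθ) := fun u x =>
  Subtype.ext (coindUnit_equi ρ θ u x)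

lemma not_isAvg_omegaMap [FiniteDimensional k V] (ρ : Representation k G V) (θ : V →ₗ[k] V)
    (hθ : avg ρ ρ θ = 0) (ht : LinearMap.trace k V θ ≠ 0) :
    ¬ IsAvg ρ (omegaRep ρ) (omegaMap ρ θ hθ) := by
  rintro ⟨h, hh⟩
  let h' (g : G) : V →ₗ[k] V := LinearMap.proj g ∘ₗ (LinearMap.ker (coindCounit ρ)).subtype ∘ₗ h
  have h1 : θ = ∑ g, h' g ∘ₗ ρ g⁻¹ := by
    ext v
    have := congrArg (fun F => F.1 1) (LinearMap.congr_fun hh v)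
    simp only [avg_apply, AddSubmonoidClass.coe_finsetSum, Finset.sum_apply] at this
    simpa [omegaMap, omegaRep, h'] using this
  have h2 : ∑ g, ρ g⁻¹ ∘ₗ h' g = 0 := by
    ext v
    have := (h v).2
    rw [LinearMap.mem_ker, coindCounit_apply] at this
    simpa [h'] using this
  apply ht
  rw [h1, map_sum, ← (LinearMap.trace k V).map_zero, ← h2, map_sum]
  exact Finset.sum_congr rfl fun g _ => LinearMap.trace_comp_comm' _ _

lemma isAvg_omegaMap_comp [FiniteDimensional k X] [FiniteDimensional k V]
    {ρ : Representation k G V} {σ : Representation k G X} (θ : V →ₗ[k] V)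
    (hθ : avg ρ ρ θ = 0) {a : X →ₗ[k] V} (ha : Equi σ ρ a)
    (h : ∀ b : V →ₗ[k] X, Equi ρ σ b → LinearMap.trace k V (θ ∘ₗ a ∘ₗ b) = 0) :
    IsAvg σ (omegaRep ρ) (omegaMap ρ θ hθ ∘ₗ a) := by
  classical
  let L₁ : (G → X →ₗ[k] V) →ₗ[k] (X →ₗ[k] V) :=
    ∑ g, LinearMap.lcomp k V (σ g⁻¹) ∘ₗ LinearMap.proj g
  let L₂ : (G → X →ₗ[k] V) →ₗ[k] (X →ₗ[k] V) :=
    ∑ g, LinearMap.llcomp k X V V (ρ g⁻¹) ∘ₗ LinearMap.proj g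
  have hL₁ (F) : L₁ F = ∑ g, F g ∘ₗ σ g⁻¹ := by
    simp only [L₁, LinearMap.sum_apply]
    rfl
  have hL₂ (F) : L₂ F = ∑ g, ρ g⁻¹ ∘ₗ F g := by
    simp only [L₂, LinearMap.sum_apply]
    rfl
  have hmem : θ ∘ₗ a ∈ (LinearMap.ker L₂).map L₁ := by
    by_contra hne
    obtain ⟨Λ, hΛ, hU⟩ := Submodule.exists_le_ker_of_notMem hne
    obtain ⟨b, hb⟩ := exists_trace_eq Λ
    apply hΛ
    rw [hb, LinearMap.trace_comp_comm']
    refine h b fun s v => ?_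
    have : b ∘ₗ ρ s - σ s ∘ₗ b = 0 := by
      refine eq_zero_of_trace_comp _ fun B => ?_
      let F : G → X →ₗ[k] V := fun g =>
        (if g = s⁻¹ then B else 0) - (if g = 1 then ρ s ∘ₗ B else 0)
      have h1 : L₂ F = 0 := by
        have e (g) : ρ g⁻¹ ∘ₗ F g =
            (if g = s⁻¹ then ρ s ∘ₗ B else 0) - (if g = 1 then ρ s ∘ₗ B else 0) := by
          ext x
          simp only [F]
          split_ifs <;> simp_all
        simp [hL₂, e]
      have h2 : L₁ F = B ∘ₗ σ s - ρ s ∘ₗ B := by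
        have e (g) : F g ∘ₗ σ g⁻¹ =
            (if g = s⁻¹ then B ∘ₗ σ s else 0) - (if g = 1 then ρ s ∘ₗ B else 0) := by
          ext x
          simp only [F]
          split_ifs <;> simp_all
        simp [hL₁, e]
      have h3 : Λ (L₁ F) = 0 := hU ⟨F, h1, rfl⟩
      rw [h2, hb, LinearMap.comp_sub, map_sub, ← LinearMap.comp_assoc,
        LinearMap.trace_comp_comm'] at h3
      rw [LinearMap.sub_comp, map_sub, ← neg_eq_zero, neg_sub]
      exact h3
    exact sub_eq_zero.mp (LinearMap.congr_fun this v)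
  obtain ⟨F, hF, hFθ⟩ := hmem
  replace hF : L₂ F = 0 := hF
  rw [hL₂] at hF
  rw [hL₁] at hFθ
  refine ⟨(LinearMap.pi F).codRestrict _ fun x => ?_, ?_⟩
  · rw [LinearMap.mem_ker, coindCounit_apply]
    simpa using LinearMap.congr_fun hF x
  · ext x y
    rw [avg_apply]
    simp only [AddSubmonoidClass.coe_finsetSum, Finset.sum_apply]
    have h1 := LinearMap.congr_fun hFθ (σ y x)
    rw [LinearMap.comp_apply, ha] at h1
    refine h1.symm.trans ?_
    rw [LinearMap.sum_apply, ← Equiv.sum_comp (Equiv.mulLeft y)]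
    refine Finset.sum_congr rfl fun u _ => ?_
    simp [omegaRep]

end Ghost

section GhostMap

variable {k G : Type} [Field k] [Group G]
variable {X Y Z V : Type} [AddCommGroup X] [Module k X] [AddCommGroup Y] [Module k Y]
  [AddCommGroup Z] [Module k Z] [AddCommGroup V] [Module k V]
variable {ρ : Representation k G X} {σ : Representation k G Y} {τ : Representation k G Z}

/-- A representation as a module over the group algebra. -/
noncomputable abbrev toMod (ρ : Representation k G X) : ModuleCat (MonoidAlgebra k G) :=
  ModuleCat.of (MonoidAlgebra k G) ρ.asModule

/-- The module map given by an equivariant map of representations. -/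
noncomputable def Equi.asHom {f : X →ₗ[k] Y} (hf : Equi ρ σ f) :
    ρ.asModule →ₗ[MonoidAlgebra k G] σ.asModule :=
  Equi.toHom (k := k) (G := G) (X := ρ.asModule) (Y := σ.asModule) (f := f) (by
    rw [rep_asModule, rep_asModule]
    exact hf)

/-- A short exact sequence of modules from one of representations. -/
noncomputable def SES.ofEqui {i : X →ₗ[k] Y} {q : Y →ₗ[k] Z} (hi : Equi ρ σ i) (hq : Equi σ τ q)
    (inj : Function.Injective i) (surj : Function.Surjective q)
    (exact : ∀ y, q y = 0 ↔ ∃ x, i x = y) : SES (toMod ρ) (toMod σ) (toMod τ) where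
  i := ModuleCat.ofHom hi.asHom
  p := ModuleCat.ofHom hq.asHom
  inj := inj
  surj := surj
  exact := exact

variable [Fintype G]

lemma stablyZero_ofHom_iff {f : X →ₗ[k] Y} (hf : Equi ρ σ f) :
    StablyZero (ModuleCat.ofHom hf.asHom) ↔ IsAvg ρ σ f := by
  rw [stablyZero_iff (k := k) (G := G) (X := ρ.asModule) (Y := σ.asModule), rep_asModule,
    rep_asModule]
  exact Iff.rfl

lemma stablyZero_comp_ofHom {M : ModuleCat (MonoidAlgebra k G)} [Module k M]
    [IsScalarTower k (MonoidAlgebra k G) M] (g : M ⟶ toMod ρ) {f : X →ₗ[k] Y} (hf : Equi ρ σ f)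
    (h : IsAvg (rep k G M) σ (f ∘ₗ (g.hom.restrictScalars k : M →ₗ[k] X))) :
    StablyZero (g ≫ ModuleCat.ofHom hf.asHom) := by
  refine (stablyZero_iff (k := k) (G := G) (X := M) (Y := σ.asModule) _).mpr ?_
  rw [rep_asModule]
  exact h

lemma projective_toMod (h : IsAvg ρ ρ LinearMap.id) : Projective (toMod ρ) := by
  refine (IsProjective.iff_projective _).mp (projective_of_isAvg (k := k) (G := G) ?_)
  rw [rep_asModule]
  exact h

lemma projective_funRep : Projective (toMod (funRep k G X)) := by
  classical
  exact projective_toMod ⟨_, avg_unitProj.symm⟩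

lemma inThick_omegaRep {M : ModuleCat (MonoidAlgebra k G)} (h : InThick M (toMod ρ)) :
    InThick M (toMod (omegaRep ρ)) := by
  classical
  refine .ext₃ (SES.ofEqui (omegaRep_subtype ρ) (coindCounit_equi ρ) Subtype.val_injective
    (fun x => ⟨Pi.single 1 x, ?_⟩) fun y => ?_) (.proj _ projective_funRep) h
  · rw [coindCounit_apply, Finset.sum_eq_single 1]
    · simp
    · intro g _ hg
      simp [hg]
    · simp
  · exact ⟨fun h => ⟨⟨y, h⟩, rfl⟩, fun ⟨x, hx⟩ => hx ▸ x.2⟩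

theorem exists_ghost [FiniteDimensional k X] (ρ : Representation k G X)
    {M : ModuleCat (MonoidAlgebra k G)} (hthick : InThick M (toMod ρ))
    (P : Subgroup G) [Fintype P]
    (hid : ¬ IsAvg (ρ.comp P.subtype) (ρ.comp P.subtype) LinearMap.id)
    (Ωk : ℤ → ModuleCat (MonoidAlgebra k G))
    (hfin : ∀ i [Module k (Ωk i)] [IsScalarTower k (MonoidAlgebra k G) (Ωk i)],
      FiniteDimensional k (Ωk i))
    (hΩ : ∀ i [Module k (Ωk i)] [IsScalarTower k (MonoidAlgebra k G) (Ωk i)],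
      ∀ (a : Ωk i →ₗ[k] X) (b : X →ₗ[k] Ωk i), Equi (rep k G (Ωk i)) ρ a →
        Equi ρ (rep k G (Ωk i)) b →
        IsAvg (resRep (k := k) P (Ωk i)) (resRep (k := k) P (Ωk i)) (b ∘ₗ a)) :
    ∃ M' N : ModuleCat (MonoidAlgebra k G), InThick M M' ∧ InThick M N ∧
      ∃ f : M' ⟶ N, ¬ StablyZero f ∧ ∀ (i : ℤ) (g : Ωk i ⟶ M'), StablyZero (g ≫ f) := by
  obtain ⟨θ, ht, hθ, hsep⟩ := exists_separating_endo ρ P hid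
  refine ⟨toMod ρ, toMod (omegaRep ρ), hthick, inThick_omegaRep hthick,
    ModuleCat.ofHom (omegaMap_equi ρ θ hθ).asHom, ?_, fun i g => ?_⟩
  · rw [stablyZero_ofHom_iff]
    exact not_isAvg_omegaMap ρ θ hθ ht
  · let _ : Module k (Ωk i) := groundModule k G (Ωk i)
    have := groundModule_tower (k := k) (G := G) (Ωk i)
    have := hfin i
    let a : Ωk i →ₗ[k] X := g.hom.restrictScalars k
    have ha : Equi (rep k G (Ωk i)) ρ a := by
      have := equi_restrictScalars (k := k) g.hom
      rw [rep_asModule] at this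
      exact this
    refine stablyZero_comp_ofHom g _ ?_
    refine isAvg_omegaMap_comp θ hθ ha fun b hb => ?_
    refine hsep ⟨a ∘ₗ b, ha.comp hb⟩ fun y => ?_
    have h1 := hΩ i (y.1 ∘ₗ a) b (y.2.comp ha) hb
    exact (h1.comp_right (hb.res P)).comp_left (ha.res P)

end GhostMap

section Strip

variable {k Q : Type} [Field k] [Group Q] [Fintype Q]
variable {X Y : Type} [AddCommGroup X] [Module k X] [AddCommGroup Y] [Module k Y]

/-- A composite through a representation with small core which is a scalar up to averages
is an average. -/
theorem isAvg_comp_of_small_core {p : ℕ} [hp : Fact p.Prime] [CharP k p] (hQ : IsPGroup p Q)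
    {ξ : Representation k Q X} {η : Representation k Q Y} [FiniteDimensional k X]
    [FiniteDimensional k Y] (hX : StablyScalar ξ) (hdim : DimUnit (Nat.card Q) (Module.finrank k X))
    (hsmall : Module.finrank k Y + 2 ≤
      Nat.card Q * (Module.finrank k (LinearMap.range η.norm) + 1))
    (hpair : ∀ w : Y, (∀ u, η u w = w) → ∀ β : Y →ₗ[k] k, (∀ u y, β (η u y) = β y) → β w = 0)
    {a : X →ₗ[k] Y} {b : Y →ₗ[k] X} (ha : Equi ξ η a) (hb : Equi η ξ b) :
    IsAvg ξ ξ (b ∘ₗ a) := by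
  obtain ⟨c, h, hc⟩ := hX _ (hb.comp ha)
  suffices c = 0 by
    rw [this, zero_smul, sub_zero] at hc
    exact ⟨h, hc⟩
  have hinv (s : X) (hs : ∀ u, ξ u s = s) : b (a s) = c • s + ξ.norm (h s) := by
    rw [← norm_of_avg_invariant h hs, ← hc]
    simp
  obtain ⟨e, hee, he, hN, -, hXdim⟩ := exists_strip hQ ξ
  obtain ⟨e', hee', he', -, ⟨h', hh'⟩, hYdim⟩ := exists_strip hQ η
  by_cases hlt : Module.finrank k (LinearMap.range e') < Module.finrank k (LinearMap.range e)
  · let W : Submodule k X := LinearMap.range e ⊓ LinearMap.ker (e' ∘ₗ a)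
    have hWinv : ∀ u, ∀ x ∈ W, ξ u x ∈ W := by
      rintro u _ ⟨⟨x, rfl⟩, hx⟩
      refine ⟨⟨ξ u x, hee u x⟩, ?_⟩
      have hx' : e' (a (e x)) = 0 := hx
      change e' (a (ξ u (e x))) = 0
      rw [ha, hee', hx', map_zero]
    have hWne : W ≠ ⊥ := by
      let φ : LinearMap.range e →ₗ[k] LinearMap.range e' :=
        (e'.rangeRestrict ∘ₗ a) ∘ₗ (LinearMap.range e).subtype
      have := LinearMap.ker_ne_bot_of_finrank_lt (f := φ) hlt
      obtain ⟨x, hx, hx0⟩ := (Submodule.ne_bot_iff _).mp this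
      refine (Submodule.ne_bot_iff _).mpr ⟨x.1, ⟨x.2, ?_⟩, fun h => hx0 (Subtype.ext h)⟩
      exact congrArg Subtype.val (LinearMap.mem_ker.mp hx)
    obtain ⟨s, ⟨⟨x, hx⟩, hsa⟩, hs0, hs⟩ := exists_invariant hQ ξ W hWinv hWne
    replace hsa : e' (a s) = 0 := hsa
    have hes : e s = s := by rw [← hx, he]
    have has : ∀ u, η u (a s) = a s := fun u => by rw [← ha, hs]
    have h1 : a s = η.norm (h' (a s)) := by
      rw [← norm_of_avg_invariant h' has, ← hh']
      simp [hsa]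
    have h2 := hinv s hs
    rw [h1, hb.norm_comm] at h2
    have h3 := congrArg e h2
    rw [map_add, map_smul, hes, hee.norm_comm, hee.norm_comm] at h3
    have hN' (y : X) : ξ.norm (e y) = 0 := hN y
    rw [hN', hN', add_zero] at h3
    exact (smul_eq_zero.mp h3.symm).resolve_right hs0
  · have hdim1 : Module.finrank k (LinearMap.range e) = 1 := by
      have h1 : Module.finrank k (LinearMap.range e) + 2 ≤ Nat.card Q := by
        rw [mul_add, mul_one] at hsmall
        omega
      have h2 : DimUnit (Nat.card Q) (Module.finrank k (LinearMap.range e)) := by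
        rw [hXdim] at hdim
        unfold DimUnit at hdim ⊢
        push_cast at hdim
        refine hdim.imp (fun hd => ?_) fun hd => ?_
        · have := hd.sub (dvd_mul_right (Nat.card Q : ℤ)
            (Module.finrank k (LinearMap.range ξ.norm)))
          ring_nf at this ⊢
          exact this
        · have := hd.sub (dvd_mul_right (Nat.card Q : ℤ)
            (Module.finrank k (LinearMap.range ξ.norm)))
          ring_nf at this ⊢
          exact this
      rcases h2 with h2 | h2
      · by_contra hne
        have := Int.eq_zero_of_abs_lt_dvd h2 (by rw [abs_lt]; omega)
        omega
      · have := Int.le_of_dvd (by omega) h2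
        omega
    obtain ⟨s, ⟨x, hx⟩, hs0, hs⟩ := exists_invariant hQ ξ (LinearMap.range e)
      (by rintro u _ ⟨x, rfl⟩; exact ⟨ξ u x, hee u x⟩)
      (fun h => by rw [h] at hdim1; simp at hdim1)
    have hes : e s = s := by rw [← hx, he]
    have hmul (y : X) : ∃ t : k, e y = t • s := by
      obtain ⟨t, ht⟩ := exists_smul_eq_of_finrank_eq_one hdim1
        (x := (⟨s, x, hx⟩ : LinearMap.range e)) (fun h => hs0 (congrArg Subtype.val h))
        ⟨e y, y, rfl⟩
      exact ⟨t, (congrArg Subtype.val ht).symm⟩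
    obtain ⟨φ, hφ⟩ := Module.Projective.exists_dual_eq_one k hs0
    have hφ' (u : Q) (y : X) : φ (e (ξ u y)) = φ (e y) := by
      obtain ⟨t, ht⟩ := hmul y
      rw [hee, ht, map_smul, hs]
    have h1 := hpair (a s) (fun u => by rw [← ha, hs]) (φ ∘ₗ e ∘ₗ b)
      fun u y => by simp [hb u y, hφ']
    have h2 : φ (e (ξ.norm (h s))) = 0 := by
      rw [hee.norm_comm, hN, map_zero]
    simp only [LinearMap.comp_apply] at h1
    rw [hinv s hs, map_add, map_add, h2, map_smul, hes, map_smul, hφ] at h1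
    simpa using h1

end Strip

section HomSum

variable {k Q : Type} [Field k] [Group Q] [Fintype Q]
variable {θ η : Q → k}

lemma sum_hom_of_subgroup (hθ : ∀ u v, θ (u * v) = θ u + θ v) (K : Subgroup Q)
    (hK : (Nat.card K : k) = 0) (hi : (K.index : k) = 0) : ∑ u, θ u = 0 := by
  classical
  rw [sum_cosets K]
  simp only [hθ, Finset.sum_add_distrib, Finset.sum_const, Finset.card_univ, nsmul_eq_mul,
    ← Nat.card_eq_fintype_card, hK, zero_mul, zero_add]
  rw [Subgroup.index] at hi
  rw [hi, zero_mul]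

lemma sum_hom_mul_of_subgroup (hθ : ∀ u v, θ (u * v) = θ u + θ v)
    (hη : ∀ u v, η (u * v) = η u + η v) (K : Subgroup Q) [Fintype K]
    (hK : (Nat.card K : k) = 0) (hKθ : ∑ u : K, θ u = 0) (hKη : ∑ u : K, η u = 0)
    (h : (K.index : k) = 0 ∨ ∑ u : K, θ u * η u = 0) : ∑ u, θ u * η u = 0 := by
  classical
  rw [sum_cosets K]
  have (q : Q ⧸ K) : ∑ u : K, θ (q.out * u) * η (q.out * u) = ∑ u : K, θ u * η u := by
    simp only [hθ, hη, add_mul, mul_add, Finset.sum_add_distrib, ← Finset.sum_mul,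
      ← Finset.mul_sum, hKθ, hKη]
    simp [← Nat.card_eq_fintype_card, hK]
  simp only [this]
  rw [Finset.sum_const, Finset.card_univ, nsmul_eq_mul, ← Nat.card_eq_fintype_card]
  rcases h with h | h
  · rw [Subgroup.index] at h
    rw [h, zero_mul]
  · rw [h, mul_zero]

lemma sum_hom_eq_zero {p : ℕ} [hp : Fact p.Prime] [CharP k p] (hQ : IsPGroup p Q)
    (hcard : 3 ≤ Nat.card Q) (hθ : ∀ u v, θ (u * v) = θ u + θ v) : ∑ u, θ u = 0 := by
  obtain ⟨n, hn⟩ := IsPGroup.iff_card.mp hQ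
  by_cases h2 : p = 2
  · subst h2
    have hn2 : 2 ≤ n := by
      by_contra h
      have : 2 ^ n ≤ 2 ^ 1 := Nat.pow_le_pow_right (by norm_num) (by omega)
      omega
    obtain ⟨K, hK⟩ := Sylow.exists_subgroup_card_pow_prime (G := Q) 2 (n := 1)
      (by rw [hn]; exact pow_dvd_pow _ (by omega))
    refine sum_hom_of_subgroup hθ K ?_ ?_
    · rw [CharP.cast_eq_zero_iff k 2, hK, pow_one]
    · rw [CharP.cast_eq_zero_iff k 2]
      have h1 := K.card_mul_index
      rw [hK, hn] at h1
      obtain ⟨m, rfl⟩ := Nat.exists_eq_add_of_le hn2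
      rw [pow_add, pow_one] at h1
      exact ⟨2 ^ m, by omega⟩
  · have h1 : θ 1 = 0 := by simpa using hθ 1 1
    have hinv (u) : θ u⁻¹ = -θ u := by
      have := hθ u⁻¹ u
      rw [inv_mul_cancel, h1] at this
      exact eq_neg_of_add_eq_zero_left this.symm
    have h := Equiv.sum_comp (Equiv.inv Q) θ
    simp only [Equiv.inv_apply, hinv, Finset.sum_neg_distrib] at h
    have h3 : (2 : k) * ∑ u, θ u = 0 := by linear_combination -h
    refine (mul_eq_zero.mp h3).resolve_left fun h4 => h2 ?_
    have : ((2 : ℕ) : k) = 0 := by exact_mod_cast h4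
    rw [CharP.cast_eq_zero_iff k p] at this
    exact (Nat.prime_dvd_prime_iff_eq hp.out Nat.prime_two).mp this

lemma sum_hom_mul_eq_zero {p : ℕ} [hp : Fact p.Prime] [CharP k p] (hQ : IsPGroup p Q)
    (hcard : 4 ≤ Nat.card Q) (hkl : ¬ IsKleinFour Q) (hθ : ∀ u v, θ (u * v) = θ u + θ v)
    (hη : ∀ u v, η (u * v) = η u + η v) : ∑ u, θ u * η u = 0 := by
  classical
  obtain ⟨n, hn⟩ := IsPGroup.iff_card.mp hQ
  have hsub (m : ℕ) (hm : m < n) (hm3 : 3 ≤ p ^ m) : ∑ u, θ u * η u = 0 := by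
    obtain ⟨K, hK⟩ := Sylow.exists_subgroup_card_pow_prime (G := Q) p (n := m)
      (by rw [hn]; exact pow_dvd_pow _ hm.le)
    have hKp : IsPGroup p K := hQ.to_subgroup K
    refine sum_hom_mul_of_subgroup hθ hη K ?_
      (sum_hom_eq_zero hKp (by omega) (θ := fun u : K => θ u) fun u v => hθ u v)
      (sum_hom_eq_zero hKp (by omega) (θ := fun u : K => η u) fun u v => hη u v) (.inl ?_)
    · rw [hK, CharP.cast_eq_zero_iff k p]
      refine dvd_pow_self p ?_
      rintro rfl
      simp at hm3
    · rw [CharP.cast_eq_zero_iff k p]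
      have h1 := K.card_mul_index
      rw [hK, hn] at h1
      obtain ⟨j, rfl⟩ := Nat.exists_eq_add_of_lt hm
      rw [pow_succ, pow_add, mul_assoc] at h1
      have := Nat.eq_of_mul_eq_mul_left (pow_pos hp.out.pos m) h1
      exact ⟨p ^ j, by rw [this, mul_comm]⟩
  rcases lt_trichotomy p 3 with hlt | rfl | hgt
  · obtain rfl : p = 2 := by have := hp.out.two_le; omega
    have hn2 : 2 ≤ n := by
      by_contra h
      have : 2 ^ n ≤ 2 ^ 1 := Nat.pow_le_pow_right (by norm_num) (by omega)
      omega
    rcases hn2.eq_or_lt with rfl | hn3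
    · obtain ⟨u, hu⟩ : ∃ u : Q, u ^ 2 ≠ 1 := by
        by_contra! h
        refine hkl ⟨hn, ?_⟩
        have h1 := Monoid.exponent_dvd_of_forall_pow_eq_one h
        refine ((Nat.dvd_prime Nat.prime_two).mp h1).resolve_left fun h2 => ?_
        have := Monoid.exp_eq_one_iff.mp h2
        rw [Nat.card_eq_one_iff_unique.mpr ⟨this, ⟨1⟩⟩] at hn
        norm_num at hn
      have hu4 : (u ^ 2) ^ 2 = 1 := by
        rw [← pow_mul, show 2 * 2 = Nat.card Q by rw [hn]; norm_num]
        exact pow_card_eq_one'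
      have ho : orderOf (u ^ 2) = 2 := orderOf_eq_prime hu4 hu
      have h2 : (2 : k) = 0 := CharTwo.two_eq_zero
      have hz {χ : Q → k} (hχ : ∀ u v, χ (u * v) = χ u + χ v)
          (v : Subgroup.zpowers (u ^ 2)) : χ v = 0 := by
        obtain ⟨v, hv⟩ := v
        obtain ⟨i, hi⟩ := (mem_zpowers_iff_mem_range_orderOf).mp hv |> Finset.mem_image.mp
        obtain ⟨-, rfl⟩ := hi
        have hodd : χ ((u ^ 2) ^ i) = i * χ (u ^ 2) := by
          induction i with
          | zero => simpa using hχ 1 1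
          | succ i ih =>
            rw [pow_succ, hχ, ih]
            · push_cast; ring
            · exact Subgroup.pow_mem _ (Subgroup.mem_zpowers _) _
        change χ ((u ^ 2) ^ i) = 0
        rw [hodd, pow_two, hχ, ← two_mul, h2]
        ring
      refine sum_hom_mul_of_subgroup hθ hη (Subgroup.zpowers (u ^ 2)) ?_ ?_ ?_ (.inr ?_)
      · rw [Nat.card_zpowers, ho]
        exact_mod_cast h2
      · simp [hz hθ]
      · simp [hz hη]
      · simp [hz hθ]
    · exact hsub 2 hn3 (by norm_num)
  · refine hsub 1 ?_ (by norm_num)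
    by_contra h
    have : 3 ^ n ≤ 3 ^ 1 := Nat.pow_le_pow_right (by norm_num) (by omega)
    omega
  · have hodd : Nat.Coprime (Nat.card Q) 2 := by
      rw [hn]
      exact Nat.Coprime.pow_left _ ((Nat.coprime_primes hp.out Nat.prime_two).mpr (by omega))
    have h := Equiv.sum_comp (powCoprime hodd) fun u => θ u * η u
    simp only [powCoprime_apply, pow_two, hθ, hη] at h
    have h3 : (3 : k) * ∑ u, θ u * η u = 0 := by
      have : ∑ u, (θ u + θ u) * (η u + η u) = 4 * ∑ u, θ u * η u := by
        rw [Finset.mul_sum]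
        exact Finset.sum_congr rfl fun u _ => by ring
      rw [this] at h
      linear_combination h
    refine (mul_eq_zero.mp h3).resolve_left fun h4 => ?_
    have : ((3 : ℕ) : k) = 0 := by exact_mod_cast h4
    rw [CharP.cast_eq_zero_iff k p] at this
    have := (Nat.prime_dvd_prime_iff_eq hp.out Nat.prime_three).mp this
    omega

end HomSum

section Heart

variable {k G : Type} [Field k] [Group G] [Fintype G]

/-- The sum of the values of a function. -/
noncomputable def sumFun (k G : Type) [Field k] [Fintype G] : (G → k) →ₗ[k] k :=
  ∑ g, LinearMap.proj g

omit [Group G] in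
@[simp] lemma sumFun_apply (F : G → k) : sumFun k G F = ∑ g, F g := by
  simp [sumFun]

/-- The functions with vanishing sum. -/
noncomputable def zeroSumRep (k G : Type) [Field k] [Group G] [Fintype G] :
    Representation k G (LinearMap.ker (sumFun k G)) :=
  (funRep k G k).subrepresentation _ fun u F hF => by
    rw [LinearMap.mem_ker, sumFun_apply] at hF
    rw [Submodule.mem_comap, LinearMap.mem_ker, sumFun_apply, ← hF]
    exact Equiv.sum_comp (Equiv.mulRight u) F

/-- The constant functions among the functions with vanishing sum. -/
def constZeroSum (k G : Type) [Field k] [Group G] [Fintype G] :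
    Submodule k (LinearMap.ker (sumFun k G)) where
  carrier := {F | ∀ y, F.1 y = F.1 1}
  add_mem' hF hF' y := by simp [hF y, hF' y]
  zero_mem' y := rfl
  smul_mem' c F hF y := by simp [hF y]

/-- The heart of the regular representation: functions with vanishing sum modulo constants. -/
noncomputable def heartRep (k G : Type) [Field k] [Group G] [Fintype G] :
    Representation k G (LinearMap.ker (sumFun k G) ⧸ constZeroSum k G) :=
  (zeroSumRep k G).quotient _ fun u _ hF y => (hF (y * u)).trans (hF (1 * u)).symm

lemma zeroSumRep_apply (g : G) (F : LinearMap.ker (sumFun k G)) (y : G) :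
    (zeroSumRep k G g F).1 y = F.1 (y * g) := rfl

lemma heartRep_mk (g : G) (F : LinearMap.ker (sumFun k G)) :
    heartRep k G g (Submodule.Quotient.mk F) = Submodule.Quotient.mk (zeroSumRep k G g F) := rfl

lemma sumFun_surjective : Function.Surjective (sumFun k G) := fun t => by
  classical
  exact ⟨Pi.single 1 t, by simp⟩

lemma sumFun_equi : Equi (funRep k G k) (Representation.trivial k G k) (sumFun k G) :=
  fun u _ => by
    rw [sumFun_apply, Representation.trivial_apply, sumFun_apply]
    exact Equiv.sum_comp (Equiv.mulRight u) _

/-- The constant functions with vanishing sum, in characteristic dividing the group order. -/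
noncomputable def constMap (h : (Fintype.card G : k) = 0) : k →ₗ[k] LinearMap.ker (sumFun k G) :=
  (LinearMap.pi fun _ => LinearMap.id).codRestrict _ fun x => by simp [h]

lemma inThick_heartRep (h : (Fintype.card G : k) = 0) :
    InThick (triv k G) (toMod (heartRep k G)) := by
  have h1 : InThick (triv k G) (toMod (zeroSumRep k G)) := by
    refine .ext₃ (SES.ofEqui (ρ := zeroSumRep k G) (i := (LinearMap.ker (sumFun k G)).subtype)
      (fun _ _ => rfl) sumFun_equi Subtype.val_injective sumFun_surjective fun y => ?_)
      (.proj _ projective_funRep) .gen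
    exact ⟨fun h => ⟨⟨y, h⟩, rfl⟩, fun ⟨x, hx⟩ => hx ▸ x.2⟩
  refine .ext₁ (SES.ofEqui (i := constMap h) (q := (constZeroSum k G).mkQ)
    (ρ := Representation.trivial k G k) (fun _ _ => rfl) (fun _ _ => rfl)
    (fun x y hxy => congrFun (congrArg Subtype.val hxy) 1)
    (Submodule.mkQ_surjective _) fun F => ?_) .gen h1
  rw [Submodule.mkQ_apply, Submodule.Quotient.mk_eq_zero]
  refine ⟨fun hF => ⟨F.1 1, Subtype.ext (funext fun y => (hF y).symm)⟩, ?_⟩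
  rintro ⟨x, rfl⟩ y
  rfl

lemma finrank_heart (h : (Fintype.card G : k) = 0) :
    Module.finrank k (LinearMap.ker (sumFun k G) ⧸ constZeroSum k G) + 2 = Nat.card G := by
  have h1 := LinearMap.finrank_range_add_finrank_ker (sumFun k G)
  rw [LinearMap.range_eq_top.mpr sumFun_surjective, finrank_top, Module.finrank_self,
    Module.finrank_fintype_fun_eq_card] at h1
  have h2 := (constZeroSum k G).finrank_quotient_add_finrank
  have h3 : Module.finrank k (constZeroSum k G) = 1 := by
    let L : k →ₗ[k] constZeroSum k G := (constMap h).codRestrict _ fun _ _ => rfl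
    rw [← Module.finrank_self k]
    refine (LinearEquiv.ofBijective L ⟨fun x y hxy => ?_, fun F => ⟨F.1.1 1, ?_⟩⟩).finrank_eq.symm
    · exact congrFun (congrArg (fun F => F.1.1) hxy) 1
    · exact Subtype.ext (Subtype.ext (funext fun y => (F.2 y).symm))
  rw [Nat.card_eq_fintype_card]
  omega

/-- Functions which are additive along the cosets of a subgroup are orthogonal. -/
lemma sum_mul_eq_zero_of_quasi_hom {p : ℕ} [hp : Fact p.Prime] [CharP k p] (P : Subgroup G)
    (hP : IsPGroup p P) (hcard : 4 ≤ Nat.card P) (hkl : ¬ IsKleinFour P)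
    {F F' : G → k} {θ θ' : P → k} (hF : ∀ y (u : P), F (y * u) = F y + θ u)
    (hF' : ∀ y (u : P), F' (y * u) = F' y + θ' u) : ∑ y, F y * F' y = 0 := by
  classical
  have hom {F : G → k} {θ : P → k} (hF : ∀ y (u : P), F (y * u) = F y + θ u) (u v : P) :
      θ (u * v) = θ u + θ v := by
    have h1 := hF 1 (u * v)
    have h2 := hF (1 * u) v
    rw [hF 1 u, mul_assoc] at h2
    rw [Subgroup.coe_mul, h2, add_assoc] at h1
    exact (add_left_cancel h1).symm
  have hcard0 : (Fintype.card P : k) = 0 := by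
    rw [← Nat.card_eq_fintype_card, CharP.cast_eq_zero_iff k p]
    obtain ⟨n, hn⟩ := IsPGroup.iff_card.mp hP
    rw [hn] at hcard ⊢
    refine dvd_pow_self p ?_
    rintro rfl
    simp at hcard
  rw [sum_cosets P]
  refine Finset.sum_eq_zero fun q _ => ?_
  simp only [hF, hF', add_mul, mul_add, Finset.sum_add_distrib, ← Finset.sum_mul,
    ← Finset.mul_sum]
  rw [sum_hom_mul_eq_zero hP hcard hkl (hom hF) (hom hF'),
    sum_hom_eq_zero hP (by omega) (hom hF), sum_hom_eq_zero hP (by omega) (hom hF')]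
  simp [hcard0]

lemma heart_pairing {p : ℕ} [hp : Fact p.Prime] [CharP k p] (P : Subgroup G)
    (hP : IsPGroup p P) (hcard : 4 ≤ Nat.card P) (hkl : ¬ IsKleinFour P)
    {w : LinearMap.ker (sumFun k G) ⧸ constZeroSum k G}
    (hw : ∀ u : P, heartRep k G u w = w)
    {β : (LinearMap.ker (sumFun k G) ⧸ constZeroSum k G) →ₗ[k] k}
    (hβ : ∀ (u : P) y, β (heartRep k G u y) = β y) : β w = 0 := by
  classical
  obtain ⟨F, rfl⟩ := Submodule.Quotient.mk_surjective _ w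
  obtain ⟨B, hB⟩ := LinearMap.exists_extend (β ∘ₗ (constZeroSum k G).mkQ)
  let F' : G → k := fun y => B (Pi.single y 1)
  have hBF (F : G → k) : B F = ∑ y, F y * F' y := by
    conv_lhs => rw [← LinearMap.sum_single_apply (ι := G) (φ := fun _ => k) F, map_sum]
    refine Finset.sum_congr rfl fun y _ => ?_
    rw [← smul_eq_mul, ← map_smul, ← Pi.single_smul, smul_eq_mul, mul_one]
  have hBβ (F : LinearMap.ker (sumFun k G)) : β (Submodule.Quotient.mk F) = B F.1 :=
    (LinearMap.congr_fun hB F).symm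
  rw [hBβ, hBF]
  refine sum_mul_eq_zero_of_quasi_hom P hP hcard hkl (θ := fun u => F.1 u - F.1 1)
    (θ' := fun u => F' u - F' 1) (fun y u => ?_) fun y u => ?_
  · have h1 := hw u
    rw [heartRep_mk, Submodule.Quotient.eq] at h1
    have h2 := h1 y
    simp only [Submodule.coe_sub, Pi.sub_apply, zeroSumRep_apply, one_mul] at h2
    linear_combination h2
  · let D : LinearMap.ker (sumFun k G) := ⟨Pi.single (y * (u : G)) 1 - Pi.single (u : G) 1,
      by simp⟩
    have h1 := hβ u (Submodule.Quotient.mk D)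
    rw [heartRep_mk, hBβ, hBβ] at h1
    have h2 : (zeroSumRep k G u D).1 = Pi.single y 1 - Pi.single 1 1 := by
      ext z
      simp [zeroSumRep_apply, D, Pi.single_apply]
    rw [h2] at h1
    simp only [D, map_sub] at h1
    simp only [F']
    linear_combination -h1

lemma index_le_finrank_norm_heart (P : Subgroup G) [Fintype P] (hm : (P.index : k) ≠ 0)
    (hcard : (Nat.card P : k) = 0) :
    P.index ≤ Module.finrank k
      (LinearMap.range (Representation.norm ((heartRep k G).comp P.subtype))) + 1 := by
  classical
  have h1 := LinearMap.finrank_range_add_finrank_ker (sumFun k (G ⧸ P))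
  have h2 := (LinearMap.range (sumFun k (G ⧸ P))).finrank_le
  rw [Module.finrank_self] at h2
  rw [Module.finrank_fintype_fun_eq_card, ← Nat.card_eq_fintype_card] at h1
  let L₀ : LinearMap.ker (sumFun k (G ⧸ P)) →ₗ[k] LinearMap.ker (sumFun k G) :=
    (LinearMap.funLeft k k (fun y : G => (y : G ⧸ P)) ∘ₗ Submodule.subtype _).codRestrict _
      fun s => by
        rw [LinearMap.mem_ker, sumFun_apply, sum_cosets P]
        simp [LinearMap.funLeft, ← Nat.card_eq_fintype_card, hcard]
  have hL₀ (s) (y : G) : (L₀ s).1 y = s.1 y := rfl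
  let L := (constZeroSum k G).mkQ ∘ₗ L₀
  have hinj : Function.Injective L := by
    rw [← LinearMap.ker_eq_bot, LinearMap.ker_eq_bot']
    intro s hs
    have hs' : ∀ y : G, s.1 y = s.1 (1 : G) := (Submodule.Quotient.mk_eq_zero _).mp hs
    have hc (x : G ⧸ P) : s.1 x = s.1 (1 : G) := by
      rw [← QuotientGroup.out_eq' x]
      exact hs' _
    have h0 := s.2
    rw [LinearMap.mem_ker, sumFun_apply] at h0
    simp only [hc, Finset.sum_const, Finset.card_univ, nsmul_eq_mul,
      ← Nat.card_eq_fintype_card] at h0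
    have h3 := (mul_eq_zero.mp h0).resolve_left hm
    ext x
    rw [hc, h3]
    rfl
  have hle : LinearMap.range L ≤
      LinearMap.range (Representation.norm ((heartRep k G).comp P.subtype)) := by
    rintro _ ⟨s, rfl⟩
    have hsum : ∑ q, s.1 q = 0 := (sumFun_apply _).symm.trans s.2
    have hout (q : G ⧸ P) (u : P) : ((q.out * u : G) : G ⧸ P) = q :=
      (QuotientGroup.eq.mpr (by simp)).trans (QuotientGroup.out_eq' q)
    refine ⟨Submodule.Quotient.mk ⟨fun y => if cosetPart P y = 1 then s.1 y else 0, ?_⟩, ?_⟩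
    · rw [LinearMap.mem_ker, sumFun_apply, sum_cosets P]
      simp [cosetPart_mul, cosetPart_out, hout, hsum]
    · have hN (F) : Representation.norm ((heartRep k G).comp P.subtype) (Submodule.Quotient.mk F) =
          (constZeroSum k G).mkQ (∑ u : P, zeroSumRep k G u F) := by
        rw [norm_apply, map_sum]
        rfl
      rw [hN]
      change _ = (constZeroSum k G).mkQ (L₀ s)
      congr 1
      refine Subtype.ext (funext fun y => ?_)
      rw [hL₀]
      simp only [AddSubmonoidClass.coe_finsetSum, Finset.sum_apply, zeroSumRep_apply,
        cosetPart_mul]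
      rw [Finset.sum_eq_single (cosetPart P y)⁻¹]
      · have : ((y * (((cosetPart P y)⁻¹ : P) : G) : G) : G ⧸ P) = y :=
          QuotientGroup.eq.mpr (by simp)
        rw [this]
        simp
      · intro u _ hu
        rw [if_neg]
        exact fun h => hu (eq_inv_of_mul_eq_one_right h)
      · simp
  have h3 := Submodule.finrank_mono hle
  rw [LinearMap.finrank_range_of_inj hinj] at h3
  have h4 : P.index = Nat.card (G ⧸ P) := rfl
  omega

theorem exists_ghost_of_not_isKleinFour {p : ℕ} [hp : Fact p.Prime] [CharP k p] (P : Sylow p G)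
    (hcard : 4 ≤ Nat.card P) (hkl : ¬ IsKleinFour P)
    (Ωk : ℤ → ModuleCat (MonoidAlgebra k G)) (hΩk : IsSyzygyFamily (triv k G) Ωk) :
    ∃ M N : ModuleCat (MonoidAlgebra k G), InThick (triv k G) M ∧ InThick (triv k G) N ∧
      ∃ f : M ⟶ N, ¬ StablyZero f ∧ ∀ (i : ℤ) (g : Ωk i ⟶ M), StablyZero (g ≫ f) := by
  classical
  have hP : IsPGroup p (P : Subgroup G) := P.isPGroup'
  replace hcard : 4 ≤ Nat.card (P : Subgroup G) := hcard
  have hpP : p ∣ Nat.card (P : Subgroup G) := by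
    obtain ⟨n, hn⟩ := IsPGroup.iff_card.mp hP
    rw [hn] at hcard ⊢
    refine dvd_pow_self p ?_
    rintro rfl
    simp at hcard
  have hPG := (P : Subgroup G).card_mul_index
  have hG : (Fintype.card G : k) = 0 := by
    rw [CharP.cast_eq_zero_iff k p, ← Nat.card_eq_fintype_card, ← hPG]
    exact hpP.mul_right _
  have hfr := finrank_heart (k := k) hG
  have hm : ((P : Subgroup G).index : k) ≠ 0 := by
    rw [Ne, CharP.cast_eq_zero_iff k p]
    exact P.not_dvd_index
  refine exists_ghost (heartRep k G) (inThick_heartRep hG) P (fun h => ?_) Ωk (fun i _ _ => ?_)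
    fun i _ _ a b ha hb => ?_
  · have h1 := card_dvd_finrank hP h
    have h2 : Nat.card (P : Subgroup G) ∣ 2 :=
      (Nat.dvd_add_right h1).mp (hfr ▸ hPG ▸ dvd_mul_right _ _)
    have := Nat.le_of_dvd (by norm_num) h2
    omega
  · exact (syzygy_stablyScalar (P : Subgroup G) hP hpP Ωk hΩk i).1
  · obtain ⟨hfd, hss, hdim⟩ := syzygy_stablyScalar (P : Subgroup G) hP hpP Ωk hΩk i
    refine isAvg_comp_of_small_core hP hss hdim ?_ (fun w hw β hβ => ?_)
      (ha.res (P : Subgroup G)) (hb.res (P : Subgroup G))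
    · rw [hfr, ← hPG]
      refine Nat.mul_le_mul_left _ (index_le_finrank_norm_heart _ hm ?_)
      rwa [CharP.cast_eq_zero_iff k p]
    · exact heart_pairing (P : Subgroup G) hP hcard hkl hw hβ

end Heart

section Cocycle

variable {k G : Type} [Field k] [Group G]

lemma exists_klein_coordinates {P : Type} [Group P] [CharP k 2] [IsKleinFour P] :
    ∃ x y : P → k, (∀ u v, x (u * v) = x u + x v) ∧ (∀ u v, y (u * v) = y u + y v) ∧
      (∃ c, x c = 1 ∧ y c = 0) ∧ (∃ d, x d = 0 ∧ y d = 1) ∧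
      ∀ u, u ≠ 1 → x u * x u + x u * y u + y u * y u = 1 := by
  obtain ⟨e⟩ := IsKleinFour.nonempty_mulEquiv (G₁ := P) (G₂ := Multiplicative (ZMod 2 × ZMod 2))
  let φ : ZMod 2 →+* k := ZMod.castHom dvd_rfl k
  refine ⟨fun u => φ (e u).toAdd.1, fun u => φ (e u).toAdd.2, fun u v => by simp,
    fun u v => by simp, ⟨e.symm (.ofAdd (1, 0)), by simp⟩, ⟨e.symm (.ofAdd (0, 1)), by simp⟩, ?_⟩
  intro u hu
  have h1 : (e u).toAdd ≠ 0 := fun h => hu (by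
    apply e.injective
    rw [map_one]
    exact h)
  have h2 : ∀ v : ZMod 2 × ZMod 2, v ≠ 0 → v.1 * v.1 + v.1 * v.2 + v.2 * v.2 = 1 := by decide
  simp only [← map_mul, ← map_add, h2 _ h1, map_one]

/-- The component of an element in a subgroup, relative to representatives of right cosets. -/
noncomputable def rightPart (P : Subgroup G) (z : G) : P := (cosetPart P z⁻¹)⁻¹

lemma rightPart_mul (P : Subgroup G) (u : P) (z : G) :
    rightPart P (u * z) = u * rightPart P z := by
  have := cosetPart_mul P z⁻¹ u⁻¹
  rw [rightPart, mul_inv_rev, ← Subgroup.coe_inv, this, mul_inv_rev, inv_inv, rightPart]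

lemma rightPart_out (P : Subgroup G) (q : G ⧸ P) : rightPart P q.out⁻¹ = 1 := by
  rw [rightPart, inv_inv, cosetPart_out, inv_one]

/-- The change of the component in a subgroup under right multiplication. -/
noncomputable def diffPart (P : Subgroup G) (z g : G) : P :=
  (rightPart P z)⁻¹ * rightPart P (z * g)

lemma diffPart_mul_left (P : Subgroup G) (u : P) (z g : G) :
    diffPart P (u * z) g = diffPart P z g := by
  rw [diffPart, mul_assoc, rightPart_mul, rightPart_mul]
  group
  simp [diffPart]

lemma diffPart_mul (P : Subgroup G) (z g h : G) :
    diffPart P z (g * h) = diffPart P z g * diffPart P (z * g) h := by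
  simp [diffPart, mul_assoc]

lemma rightPart_mul_diffPart (P : Subgroup G) (z g : G) :
    rightPart P z * diffPart P z g = rightPart P (z * g) := by
  simp [diffPart]

lemma left_invariant_out {M : Type} (P : Subgroup G) {ψ : G → M}
    (hψ : ∀ (u : P) z, ψ (u * z) = ψ z) (y : G) (q : G ⧸ P) :
    ψ (y⁻¹ • q).out⁻¹ = ψ (q.out⁻¹ * y) := by
  have h1 := out_mul_cosetPart P (y⁻¹ * q.out)
  have h2 : ((y⁻¹ * q.out : G) : G ⧸ P) = y⁻¹ • q := by
    conv_rhs => rw [← QuotientGroup.out_eq' q]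
    rfl
  rw [h2] at h1
  rw [← hψ (cosetPart P (y⁻¹ * q.out))⁻¹, Subgroup.coe_inv, ← mul_inv_rev, h1, mul_inv_rev, inv_inv]

lemma sum_translate_of_left_invariant {M : Type} [AddCommMonoid M] (P : Subgroup G)
    [Fintype (G ⧸ P)] {ψ : G → M} (hψ : ∀ (u : P) z, ψ (u * z) = ψ z) (y : G) :
    ∑ q : G ⧸ P, ψ (q.out⁻¹ * y) = ∑ q : G ⧸ P, ψ q.out⁻¹ := by
  rw [← Equiv.sum_comp (MulAction.toPerm y⁻¹) fun q : G ⧸ P => ψ q.out⁻¹]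
  exact Finset.sum_congr rfl fun q _ => (left_invariant_out P hψ y q).symm

variable {P : Subgroup G} [Fintype (G ⧸ P)]

/-- The transferred cocycle of a bilinear form on a subgroup. -/
noncomputable def transferCocycle (β : P → P → k) (g y : G) : k :=
  ∑ q : G ⧸ P, β (rightPart P (q.out⁻¹ * y)) (diffPart P (q.out⁻¹ * y) g)

lemma transferCocycle_one {β : P → P → k} (hr : ∀ u v w, β u (v * w) = β u v + β u w) (y : G) :
    transferCocycle β 1 y = 0 := by
  have h (u) : β u 1 = 0 := by simpa using hr u 1 1
  simp [transferCocycle, diffPart, h]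

lemma transferCocycle_mul {β : P → P → k} (hl : ∀ u v w, β (u * v) w = β u w + β v w)
    (hr : ∀ u v w, β u (v * w) = β u v + β u w) (g h y : G) :
    transferCocycle β g y + transferCocycle β h (y * g) - transferCocycle β (g * h) y =
      ∑ q : G ⧸ P, β (diffPart P q.out⁻¹ g) (diffPart P (q.out⁻¹ * g) h) := by
  have h1 := sum_translate_of_left_invariant P
    (ψ := fun z => β (diffPart P z g) (diffPart P (z * g) h))
    (fun u z => by rw [mul_assoc, diffPart_mul_left, diffPart_mul_left]) y
  rw [← h1]
  simp only [transferCocycle, ← Finset.sum_add_distrib, ← Finset.sum_sub_distrib]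
  refine Finset.sum_congr rfl fun q _ => ?_
  rw [diffPart_mul, hr, ← mul_assoc, ← rightPart_mul_diffPart P (q.out⁻¹ * y) g, hl]
  ring

lemma transferCocycle_involution [CharP k 2] {β : P → P → k}
    (hl : ∀ u v w, β (u * v) w = β u w + β v w) (hr : ∀ u v w, β u (v * w) = β u v + β u w)
    (hq : ∀ u, u ≠ 1 → β u u = 1) (hP : ∀ u : P, u * u = 1) (hidx : (P.index : k) = 1)
    {c : P} (hc : c ≠ 1) (y : G) :
    transferCocycle β (c : G) (y * c) = transferCocycle β (c : G) y + 1 := by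
  classical
  have hcc : (c : G) * c = 1 := congrArg Subtype.val (hP c)
  have h1 := transferCocycle_mul hl hr (c : G) c y
  rw [hcc, transferCocycle_one hr, sub_zero] at h1
  suffices ∑ q : G ⧸ P, β (diffPart P q.out⁻¹ c) (diffPart P (q.out⁻¹ * c) c) = 1 by
    rw [this] at h1
    rw [← sub_eq_zero, CharTwo.sub_eq_add, ← add_assoc,
      add_comm (transferCocycle β (c : G) (y * c)), h1, CharTwo.add_self_eq_zero]
  have h2 (z : G) : diffPart P (z * c) c = diffPart P z c := by
    have := diffPart_mul P z c c
    rw [hcc] at this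
    have h3 : diffPart P z 1 = 1 := by simp [diffPart]
    rw [h3] at this
    exact mul_left_cancel (this.symm.trans (hP _).symm)
  simp only [h2]
  have hinv : (c : G)⁻¹ = c := inv_eq_of_mul_eq_one_left hcc
  have hsum : ∑ q : G ⧸ P, (β (diffPart P q.out⁻¹ c) (diffPart P q.out⁻¹ c) + 1) = 0 := by
    refine Finset.sum_involution (fun q _ => (c : G) • q) (fun q _ => ?_) (fun q _ hne h => ?_)
      (fun _ _ => Finset.mem_univ _) (fun q _ => ?_)
    · have h3 := left_invariant_out P (ψ := fun z => β (diffPart P z c) (diffPart P z c))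
        (fun u z => by rw [diffPart_mul_left]) c q
      simp only [h2, hinv] at h3
      rw [h3, CharTwo.add_self_eq_zero]
    · have h3 := congrArg (fun z => z⁻¹) (out_mul_cosetPart P ((c : G) * q.out))
      have h4 : (((c : G) * q.out : G) : G ⧸ P) = q := by
        conv_rhs => rw [← h, ← QuotientGroup.out_eq' q]
        rfl
      rw [h4] at h3
      simp only [mul_inv_rev, hinv] at h3
      apply hne
      rw [hq _ fun h5 => ?_, CharTwo.add_self_eq_zero]
      rw [diffPart, rightPart_out, inv_one, one_mul, ← h3, ← Subgroup.coe_inv, rightPart_mul,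
        rightPart_out, mul_one] at h5
      rw [inv_eq_one.mp h5] at h3
      simp only [Subgroup.coe_one, inv_one, one_mul, left_eq_mul] at h3
      exact hc (Subtype.ext h3)
    · rw [smul_smul, hcc, one_smul]
  rw [Finset.sum_add_distrib, Finset.sum_const, Finset.card_univ, nsmul_eq_mul, mul_one,
    ← Nat.card_eq_fintype_card] at hsum
  rw [Subgroup.index] at hidx
  rw [hidx] at hsum
  rw [← sub_eq_zero, CharTwo.sub_eq_add, hsum]

end Cocycle

section Twisted

variable {k G : Type} [Field k] [Group G]

/-- The constant functions. -/
def constFun (k G : Type) [Field k] [Group G] : Submodule k (G → k) where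
  carrier := {F | ∀ y, F y = F 1}
  add_mem' hF hF' y := by simp [hF y, hF' y]
  zero_mem' y := rfl
  smul_mem' c F hF y := by simp [hF y]

/-- The functions modulo constants. -/
noncomputable def modConstRep (k G : Type) [Field k] [Group G] :
    Representation k G ((G → k) ⧸ constFun k G) :=
  (funRep k G k).quotient _ fun u _ hF y => (hF (y * u)).trans (hF (1 * u)).symm

lemma modConstRep_mk (g : G) (F : G → k) :
    modConstRep k G g (Submodule.Quotient.mk F) = Submodule.Quotient.mk fun y => F (y * g) := rfl

lemma modConst_mk_eq {F F' : G → k} (κ : k) (h : ∀ y, F y = F' y + κ) :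
    (Submodule.Quotient.mk F : (G → k) ⧸ constFun k G) = Submodule.Quotient.mk F' := by
  rw [Submodule.Quotient.eq]
  intro y
  simp [h]

lemma exists_of_modConst_mk_eq {F F' : G → k}
    (h : (Submodule.Quotient.mk F : (G → k) ⧸ constFun k G) = Submodule.Quotient.mk F') :
    ∃ κ, ∀ y, F y = F' y + κ := by
  rw [Submodule.Quotient.eq] at h
  refine ⟨F 1 - F' 1, fun y => ?_⟩
  have := h y
  simp only [Pi.sub_apply] at this
  linear_combination this

variable {P : Subgroup G} [Fintype (G ⧸ P)]

/-- The extension of the trivial representation by functions modulo constants along the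
transferred cocycle. -/
noncomputable def twistRep {β : P → P → k} (hl : ∀ u v w, β (u * v) w = β u w + β v w)
    (hr : ∀ u v w, β u (v * w) = β u v + β u w) :
    Representation k G (k × ((G → k) ⧸ constFun k G)) where
  toFun g := LinearMap.prod (LinearMap.fst k _ _)
    (modConstRep k G g ∘ₗ LinearMap.snd k _ _ + (LinearMap.fst k _ _).smulRight
      (Submodule.Quotient.mk (transferCocycle β g) : (G → k) ⧸ constFun k G))
  map_one' := by
    have : (Submodule.Quotient.mk (transferCocycle β 1) : (G → k) ⧸ constFun k G) = 0 := by
      rw [Submodule.Quotient.mk_eq_zero]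
      intro y
      rw [transferCocycle_one hr, transferCocycle_one hr]
    refine LinearMap.ext fun x => Prod.ext rfl ?_
    simp [this]
  map_mul' g h := by
    have : (Submodule.Quotient.mk (transferCocycle β (g * h)) : (G → k) ⧸ constFun k G) =
        modConstRep k G g (Submodule.Quotient.mk (transferCocycle β h)) +
          Submodule.Quotient.mk (transferCocycle β g) := by
      rw [modConstRep_mk, ← Submodule.Quotient.mk_add]
      refine modConst_mk_eq
        (-∑ q : G ⧸ P, β (diffPart P q.out⁻¹ g) (diffPart P (q.out⁻¹ * g) h)) fun y => ?_
      rw [← transferCocycle_mul hl hr g h y, Pi.add_apply]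
      ring
    refine LinearMap.ext fun x => Prod.ext rfl ?_
    simp [this, add_assoc]

variable {β : P → P → k} (hl : ∀ u v w, β (u * v) w = β u w + β v w)
  (hr : ∀ u v w, β u (v * w) = β u v + β u w)

lemma twistRep_apply (g : G) (t : k) (F : G → k) :
    twistRep hl hr g (t, Submodule.Quotient.mk F) =
      (t, Submodule.Quotient.mk fun y => F (y * g) + t * transferCocycle β g y) := rfl

lemma inThick_twistRep [Fintype G] : InThick (triv k G) (toMod (twistRep hl hr)) := by
  have h1 : InThick (triv k G) (toMod (modConstRep k G)) := by
    refine .ext₁ (SES.ofEqui (ρ := Representation.trivial k G k)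
      (i := LinearMap.pi fun _ : G => LinearMap.id) (q := (constFun k G).mkQ)
      (fun _ _ => rfl) (fun _ _ => rfl) (fun x y hxy => congrFun hxy 1)
      (Submodule.mkQ_surjective _) fun F => ?_) .gen (.proj _ projective_funRep)
    rw [Submodule.mkQ_apply, Submodule.Quotient.mk_eq_zero]
    refine ⟨fun hF => ⟨F 1, funext fun y => (hF y).symm⟩, ?_⟩
    rintro ⟨x, rfl⟩ y
    rfl
  refine .ext₂ (SES.ofEqui (ρ := modConstRep k G) (σ := twistRep hl hr)
    (τ := Representation.trivial k G k) (i := LinearMap.inr k _ _) (q := LinearMap.fst k _ _)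
    (fun u x => Prod.ext rfl ?_) (fun _ _ => rfl) LinearMap.inr_injective
    LinearMap.fst_surjective fun x => ?_) h1 .gen
  · change modConstRep k G u x = modConstRep k G u x + (0 : k) • _
    rw [zero_smul, add_zero]
  · refine ⟨fun h => ⟨x.2, Prod.ext h.symm rfl⟩, ?_⟩
    rintro ⟨y, rfl⟩
    rfl

end Twisted

section Avg

variable {k Q X : Type} [Field k] [Group Q] [Fintype Q] [AddCommGroup X] [Module k X]

lemma isAvg_id_of_invariant_mem_range_norm {p : ℕ} [hp : Fact p.Prime] [CharP k p]
    (hQ : IsPGroup p Q) [FiniteDimensional k X] {ρ : Representation k Q X}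
    (h : ∀ x, (∀ u, ρ u x = x) → ∃ z, ρ.norm z = x) : IsAvg ρ ρ LinearMap.id := by
  obtain ⟨e, hee, he, hN, havg, -⟩ := exists_strip hQ ρ
  suffices e = 0 by rwa [this, sub_zero] at havg
  by_contra hne
  obtain ⟨x, ⟨x', hx'⟩, hx0, hinv⟩ := exists_invariant hQ ρ (LinearMap.range e)
    (by rintro u _ ⟨x, rfl⟩; exact ⟨ρ u x, hee u x⟩)
    (fun h => hne (LinearMap.range_eq_bot.mp h))
  obtain ⟨z, hz⟩ := h x hinv
  apply hx0
  rw [← hx', ← he, hx', ← hz, hee.norm_comm, hN]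

lemma trace_avg_eq_zero [FiniteDimensional k X] (hQ : (Nat.card Q : k) = 0)
    (ρ : Representation k Q X) (h : X →ₗ[k] X) :
    LinearMap.trace k X (avg ρ ρ h) = 0 := by
  have e (u : Q) : LinearMap.trace k X (ρ u ∘ₗ h ∘ₗ ρ u⁻¹) = LinearMap.trace k X h := by
    rw [LinearMap.trace_comp_comm', LinearMap.comp_assoc]
    congr 1
    ext x
    simp
  have e' : avg ρ ρ h = ∑ u, ρ u ∘ₗ h ∘ₗ ρ u⁻¹ := by
    ext x
    simp [avg_apply]
  rw [e', map_sum]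
  simp only [e]
  rw [Finset.sum_const, Finset.card_univ, ← Nat.card_eq_fintype_card, nsmul_eq_mul, hQ, zero_mul]

lemma sum_zpowers_of_mul_self {G M : Type} [Group G] [AddCommMonoid M] {c : G} (hc : c ≠ 1)
    (hcc : c * c = 1) [Fintype (Subgroup.zpowers c)] (f : G → M) :
    ∑ u : Subgroup.zpowers c, f u = f 1 + f c := by
  classical
  have h2 : orderOf c = 2 := orderOf_eq_prime (by rw [pow_two, hcc]) hc
  have : (Finset.univ : Finset (Subgroup.zpowers c)) = {1, ⟨c, Subgroup.mem_zpowers c⟩} := by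
    symm
    apply Finset.eq_univ_of_card
    rw [Finset.card_pair (fun h => hc (congrArg Subtype.val h).symm), ← Nat.card_eq_fintype_card,
      Nat.card_zpowers, h2]
  rw [this, Finset.sum_pair (fun h => hc (congrArg Subtype.val h).symm)]
  rfl

end Avg

section Klein

variable {k G : Type} [Field k] [Group G] [Fintype G] [CharP k 2]
variable {P : Subgroup G} [Fintype (G ⧸ P)] {β : P → P → k}
  (hl : ∀ u v w, β (u * v) w = β u w + β v w)
  (hr : ∀ u v w, β u (v * w) = β u v + β u w)

lemma isAvg_zpowers_twistRep (hq : ∀ u, u ≠ 1 → β u u = 1) (hP : ∀ u : P, u * u = 1)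
    (hidx : (P.index : k) = 1) {x : P → k} (hx : ∀ u v, x (u * v) = x u + x v) {c : P}
    (hxc : x c = 1) [Fintype (Subgroup.zpowers (c : G))] :
    IsAvg ((twistRep hl hr).comp (Subgroup.zpowers (c : G)).subtype)
      ((twistRep hl hr).comp (Subgroup.zpowers (c : G)).subtype) LinearMap.id := by
  have hx1 : x 1 = 0 := by simpa using hx 1 1
  have hc : c ≠ 1 := by
    rintro rfl
    exact zero_ne_one (hx1.symm.trans hxc)
  have hc' : (c : G) ≠ 1 := fun h => hc (Subtype.ext h)
  have hcc : (c : G) * c = 1 := congrArg Subtype.val (hP c)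
  have htwo (t : k) : t + t = 0 := CharTwo.add_self_eq_zero t
  have hC : IsPGroup 2 (Subgroup.zpowers (c : G)) := by
    rw [IsPGroup.iff_card]
    exact ⟨1, by rw [Nat.card_zpowers, orderOf_eq_prime (by rw [pow_two, hcc]) hc', pow_one]⟩
  have hcoc := transferCocycle_involution hl hr hq hP hidx hc
  refine isAvg_id_of_invariant_mem_range_norm hC fun w hw => ?_
  obtain ⟨t, m⟩ := w
  obtain ⟨F, rfl⟩ := Submodule.Quotient.mk_surjective _ m
  have h1 : twistRep hl hr c (t, Submodule.Quotient.mk F) = (t, Submodule.Quotient.mk F) :=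
    hw ⟨c, Subgroup.mem_zpowers _⟩
  rw [twistRep_apply] at h1
  obtain ⟨κ, hκ⟩ := exists_of_modConst_mk_eq (congrArg Prod.snd h1)
  obtain rfl : t = 0 := by
    have h2 := hκ 1
    have h3 := hκ (1 * c)
    rw [mul_assoc, hcc, mul_one, hcoc] at h3
    linear_combination h2 + h3 - htwo (t * transferCocycle β (c : G) 1) + htwo κ
  simp only [zero_mul, add_zero] at hκ
  let F₂ : G → k := fun y => F y + κ * transferCocycle β (c : G) y
  have hF₂ (y) : F₂ (y * c) = F₂ y := by
    simp only [F₂, hκ, hcoc]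
    linear_combination htwo κ
  refine ⟨(κ, Submodule.Quotient.mk fun y => F₂ y * x (cosetPart P y)), ?_⟩
  rw [norm_apply]
  refine (sum_zpowers_of_mul_self hc' hcc fun u => twistRep hl hr u
    (κ, Submodule.Quotient.mk fun y => F₂ y * x (cosetPart P y))).trans ?_
  rw [map_one, Module.End.one_apply, twistRep_apply, Prod.mk_add_mk, htwo,
    ← Submodule.Quotient.mk_add]
  congr 2
  ext y
  simp only [Pi.add_apply, hF₂, cosetPart_mul, hx, hxc]
  simp only [F₂]
  linear_combination htwo (F₂ y * x (cosetPart P y)) + htwo (κ * transferCocycle β (c : G) y)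

omit [Fintype G] [CharP k 2] in
lemma not_isAvg_twistRep [Fintype P] {x y : P → k}
    (hx : ∀ u v, x (u * v) = x u + x v) (hy : ∀ u v, y (u * v) = y u + y v)
    {c d : P} (hxc : x c = 1) (hxd : x d = 0) (hyd : y d = 1) :
    ¬ IsAvg ((twistRep hl hr).comp P.subtype) ((twistRep hl hr).comp P.subtype)
      LinearMap.id := by
  rintro ⟨h, hh⟩
  let f (χ : P → k) : k × ((G → k) ⧸ constFun k G) :=
    (0, Submodule.Quotient.mk fun z => χ (cosetPart P z))
  have key (χ : P → k) (hχ : ∀ u v, χ (u * v) = χ u + χ v) (h0 : (h (f χ)).1 = 0) (u : P) :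
      χ u = 0 := by
    have hinv (u : P) : twistRep hl hr u (f χ) = f χ := by
      rw [twistRep_apply]
      refine Prod.ext rfl (modConst_mk_eq (χ u) fun z => ?_)
      rw [cosetPart_mul, hχ, zero_mul, add_zero]
    have h1 := norm_of_avg_invariant h (ρ := (twistRep hl hr).comp P.subtype)
      (σ := (twistRep hl hr).comp P.subtype) hinv
    rw [← hh, LinearMap.id_apply, norm_apply] at h1
    obtain ⟨F, hF⟩ := Submodule.Quotient.mk_surjective _ (h (f χ)).2
    have h2 : h (f χ) = (0, Submodule.Quotient.mk F) := Prod.ext h0 hF.symm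
    have h3 (v : P) : ((twistRep hl hr).comp P.subtype v (h (f χ))).2 =
        (constFun k G).mkQ fun z => F (z * v) := by
      rw [h2]
      refine (congrArg Prod.snd (twistRep_apply hl hr v 0 F)).trans ?_
      simp
    have h4 := congrArg Prod.snd h1
    rw [Prod.snd_sum] at h4
    simp only [h3] at h4
    rw [← map_sum] at h4
    obtain ⟨κ, hκ⟩ := exists_of_modConst_mk_eq h4
    have h5 (z : G) : (∑ v : P, fun z => F (z * v)) (z * u) =
        (∑ v : P, fun z : G => F (z * v)) z := by
      simp only [Finset.sum_apply]
      rw [← Equiv.sum_comp (Equiv.mulLeft u) fun v : P => F (z * v)]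
      simp [mul_assoc]
    have h6 := hκ (1 * u)
    rw [h5, ← hκ, cosetPart_mul, hχ] at h6
    exact add_eq_left.mp h6
  have hf (s t : k) : f (fun u => s * x u + t * y u) = s • f x + t • f y := by
    refine Prod.ext ?_ ?_
    · simp [f]
    · simp only [f, Prod.snd_add, Prod.smul_snd, ← Submodule.Quotient.mk_smul,
        ← Submodule.Quotient.mk_add]
      rfl
  have h1 := key (fun u => (h (f y)).1 * x u + (-(h (f x)).1) * y u)
    (fun u v => by rw [hx, hy]; ring) (by
      rw [hf, map_add, map_smul, map_smul]
      simp [mul_comm])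
  have h2 := h1 d
  simp only [hxd, hyd, mul_zero, zero_add, mul_one, neg_eq_zero] at h2
  exact one_ne_zero (hxc.symm.trans (key x hx h2 c))

theorem exists_ghost_of_isKleinFour (P : Sylow 2 G) (hkl : IsKleinFour P)
    (Ωk : ℤ → ModuleCat (MonoidAlgebra k G)) (hΩk : IsSyzygyFamily (triv k G) Ωk) :
    ∃ M N : ModuleCat (MonoidAlgebra k G), InThick (triv k G) M ∧ InThick (triv k G) N ∧
      ∃ f : M ⟶ N, ¬ StablyZero f ∧ ∀ (i : ℤ) (g : Ωk i ⟶ M), StablyZero (g ≫ f) := by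
  classical
  have hP : IsPGroup 2 (P : Subgroup G) := P.isPGroup'
  have hcard : Nat.card (P : Subgroup G) = 4 := hkl.card_four
  have hpP : 2 ∣ Nat.card (P : Subgroup G) := by rw [hcard]; norm_num
  have hcard0 : (Nat.card (P : Subgroup G) : k) = 0 := (CharP.cast_eq_zero_iff k 2 _).mpr hpP
  have hidx : ((P : Subgroup G).index : k) = 1 := by
    obtain ⟨m, hm⟩ := Nat.odd_iff.mpr (Nat.two_dvd_ne_zero.mp P.not_dvd_index)
    rw [hm]
    push_cast
    rw [CharTwo.two_eq_zero, zero_mul, zero_add]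
  have hsq : ∀ u : (P : Subgroup G), u * u = 1 := fun u => hkl.mul_self u
  obtain ⟨x, y, hx, hy, ⟨c, hxc, -⟩, ⟨d, hxd, hyd⟩, hq⟩ :=
    exists_klein_coordinates (k := k) (P := (P : Subgroup G))
  let β (u v : (P : Subgroup G)) : k := x u * x v + x u * y v + y u * y v
  have hl (u v w) : β (u * v) w = β u w + β v w := by
    simp only [β, hx, hy]
    ring
  have hr (u v w) : β u (v * w) = β u v + β u w := by
    simp only [β, hx, hy]
    ring
  refine exists_ghost (twistRep hl hr) (inThick_twistRep hl hr) P
    (not_isAvg_twistRep hl hr hx hy hxc hxd hyd) Ωk (fun i _ _ => ?_)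
    fun i _ _ a b ha hb => ?_
  · exact (syzygy_stablyScalar (P : Subgroup G) hP hpP Ωk hΩk i).1
  · obtain ⟨hfd, hss, hdim⟩ := syzygy_stablyScalar (P : Subgroup G) hP hpP Ωk hΩk i
    obtain ⟨t, h, hh⟩ := hss _ ((hb.comp ha).res (P : Subgroup G))
    suffices t = 0 by
      rw [this, zero_smul, sub_zero] at hh
      exact ⟨h, hh⟩
    obtain ⟨h', hh'⟩ := isAvg_zpowers_twistRep hl hr hq hsq hidx hx hxc
    have h1 : LinearMap.trace k _ (a ∘ₗ b) = 0 := by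
      have h2 := comp_avg (ρ := (twistRep hl hr).comp (Subgroup.zpowers (c : G)).subtype)
        ((ha.comp hb).res (Subgroup.zpowers (c : G))) h'
      rw [← hh', LinearMap.comp_id] at h2
      rw [h2]
      refine trace_avg_eq_zero ?_ _ _
      have hc : (c : G) ≠ 1 := fun h => by
        have h3 : c = 1 := Subtype.ext h
        have h4 : x 1 = 0 := by simpa using hx 1 1
        rw [h3, h4] at hxc
        exact zero_ne_one hxc
      rw [Nat.card_zpowers, orderOf_eq_prime (p := 2)
        (by rw [pow_two]; exact congrArg Subtype.val (hsq c)) hc]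
      exact CharTwo.two_eq_zero
    have h2 := congrArg (LinearMap.trace k (Ωk i)) hh
    rw [trace_avg_eq_zero hcard0, map_sub, LinearMap.trace_comp_comm', h1, map_smul,
      LinearMap.trace_id, zero_sub, neg_eq_zero, smul_eq_mul] at h2
    refine (mul_eq_zero.mp h2).resolve_right fun h3 => ?_
    rw [CharP.cast_eq_zero_iff k 2] at h3
    rw [hcard] at hdim
    unfold DimUnit at hdim
    omega

end Klein

/-- If the Sylow `p`-subgroup of `G` has order at least `4`, then the
generating hypothesis fails for `kG`: there are modules `M, N` in `thick_G(k)` and a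
nonzero stable map `f : M ⟶ N` inducing the zero map on Tate cohomology. -/
theorem GH_fails_of_sylow_card_ge_four
    (k G : Type) [Field k] [Group G] [Fintype G]
    (p : ℕ) [Fact p.Prime] [CharP k p]
    (P : Sylow p G) (hP : 4 ≤ Nat.card P)
    (Ωk : ℤ → ModuleCat (MonoidAlgebra k G)) (hΩk : IsSyzygyFamily (triv k G) Ωk) :
    ∃ M N : ModuleCat (MonoidAlgebra k G), InThick (triv k G) M ∧ InThick (triv k G) N ∧
      ∃ f : M ⟶ N, ¬ StablyZero f ∧ ∀ (i : ℤ) (g : Ωk i ⟶ M), StablyZero (g ≫ f) := by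
  by_cases hkl : IsKleinFour P
  · obtain ⟨n, hn⟩ := IsPGroup.iff_card.mp P.isPGroup'
    have h4 : Nat.card P = 4 := hkl.card_four
    obtain rfl : p = 2 := by
      have hp := Fact.out (p := p.Prime)
      have hdvd : p ∣ 2 ^ 2 := by
        rw [show 2 ^ 2 = p ^ n from h4.symm.trans hn]
        refine dvd_pow_self p ?_
        rintro rfl
        rw [hn, pow_zero] at h4
        omega
      exact (Nat.prime_dvd_prime_iff_eq hp Nat.prime_two).mp (hp.dvd_of_dvd_pow hdvd)
    exact exists_ghost_of_isKleinFour P hkl Ωk hΩk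
  · exact exists_ghost_of_not_isKleinFour P hP hkl Ωk hΩk
end StmodGH
end
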